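/- arXiv:0812.2366 — 5 statements merged into one kernel-verified Lean document; each statement's English description precedes it below -/
import Mathlib

section
/- A finite simple graph G is chordal if and only if the Stanley–Reisner ideal I_{Delta(G)} of the clique complex of G has linear quotients. -/
open MvPolynomial

/-- The squarefree monomial `x^F = ∏_{v ∈ F} x_v`. -/
noncomputable def sqMonomial (k : Type) {V : Type} [Field k] [DecidableEq V]
    (F : Finset V) : MvPolynomial V k :=
  ∏ v ∈ F, X v

/-- A (squarefree) monomial ideal `I` has *linear quotients* if its minimal monomial
generators can be ordered `x^{m 0}, …, x^{m (t-1)}` so that for each `s` the colon ideal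
`(x^{m 0}, …, x^{m (s-1)}) : x^{m s}` is generated by a set of variables. -/
def HasLinearQuotients (k : Type) {V : Type} [Field k] [Fintype V] [DecidableEq V]
    (I : Ideal (MvPolynomial V k)) : Prop :=
  ∃ (t : ℕ) (m : Fin t → Finset V),
    (∀ a b : Fin t, m a ⊆ m b → a = b) ∧
    I = Ideal.span (Set.range fun s => sqMonomial k (m s)) ∧
    ∀ s : Fin t, ∃ S : Set V,
      Submodule.colon
          (Ideal.span {p | ∃ s' : Fin t, s' < s ∧ p = sqMonomial k (m s')})
          (Ideal.span {sqMonomial k (m s)}) =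
        Ideal.span ((fun v => (X v : MvPolynomial V k)) '' S)

/-- A finite simple graph is *chordal* if it contains no induced cycle of length at
least `4`. -/
def SimpleGraph.IsChordal {V : Type} (G : SimpleGraph V) : Prop :=
  ∀ n : ℕ, 4 ≤ n → IsEmpty (SimpleGraph.cycleGraph n ↪g G)

/-- The Stanley–Reisner ideal of the clique complex `Δ(G)` of a graph `G`: it is
generated by the squarefree monomials `x^F` over the nonfaces of `Δ(G)`, i.e. over the
sets of vertices `F` that are not cliques of `G`. -/
noncomputable def graphCliqueComplexIdeal (k : Type) {V : Type} [Field k] [Fintype V]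
    [DecidableEq V] (G : SimpleGraph V) : Ideal (MvPolynomial V k) :=
  Ideal.span {p | ∃ F : Finset V, ¬G.IsClique ↑F ∧ p = sqMonomial k F}

/-- The exponent vector of a squarefree monomial. -/
noncomputable def sqExp {V : Type} [DecidableEq V] (F : Finset V) : V →₀ ℕ :=
  ∑ v ∈ F, Finsupp.single v 1

lemma sqExp_apply {V : Type} [DecidableEq V] (F : Finset V) (v : V) :
    sqExp F v = if v ∈ F then 1 else 0 := by
  simp [sqExp, Finsupp.finsetSum_apply, Finsupp.single_apply]

lemma sqMonomial_eq (k : Type) {V : Type} [Field k] [DecidableEq V] (F : Finset V) :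
    sqMonomial k F = monomial (sqExp F) 1 := by
  rw [sqMonomial, sqExp, monomial_sum_one]; rfl

lemma sqExp_le {V : Type} [DecidableEq V] (F : Finset V) (μ : V →₀ ℕ) :
    sqExp F ≤ μ ↔ F ⊆ μ.support := by
  rw [Finsupp.le_def]
  constructor
  · intro h v hv
    have := h v
    rw [sqExp_apply, if_pos hv] at this
    simp; omega
  · intro h v
    rw [sqExp_apply]
    split_ifs with hv
    · have := h hv
      simp at this; omega
    · exact Nat.zero_le _

lemma mem_span_sq (k : Type) {V : Type} [Field k] [DecidableEq V]
    (A : Set (Finset V)) (f : MvPolynomial V k) :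
    f ∈ Ideal.span (sqMonomial k '' A) ↔ ∀ μ ∈ f.support, ∃ F ∈ A, F ⊆ μ.support := by
  have h : sqMonomial k '' A = (fun s => monomial s (1 : k)) '' (sqExp '' A) := by
    rw [Set.image_image]
    exact Set.image_congr fun F _ => sqMonomial_eq k F
  rw [h, mem_ideal_span_monomial_image]
  simp [sqExp_le]

lemma mem_colon_sq (k : Type) {V : Type} [Field k] [DecidableEq V]
    (A : Set (Finset V)) (M : Finset V) (f : MvPolynomial V k) :
    f ∈ Submodule.colon (Ideal.span (sqMonomial k '' A)) (Ideal.span {sqMonomial k M}) ↔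
      ∀ μ ∈ f.support, ∃ F ∈ A, F \ M ⊆ μ.support := by
  have h1 : f ∈ Submodule.colon (Ideal.span (sqMonomial k '' A)) (Ideal.span {sqMonomial k M}) ↔
      f * sqMonomial k M ∈ Ideal.span (sqMonomial k '' A) := by
    rw [Submodule.mem_colon]
    constructor
    · intro h
      exact h _ (Ideal.subset_span rfl)
    · intro h s hs
      obtain ⟨c, rfl⟩ := Ideal.mem_span_singleton'.1 hs
      have := Ideal.mul_mem_left _ c h
      rw [smul_eq_mul]
      convert this using 1
      ring
  have h2 : ∀ (F : Finset V) (μ : V →₀ ℕ), F ⊆ (μ + sqExp M).support ↔ F \ M ⊆ μ.support := by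
    intro F μ
    simp only [Finset.subset_iff, Finset.mem_sdiff, Finsupp.mem_support_iff, Finsupp.add_apply,
      sqExp_apply]
    constructor
    · intro h v hv
      have := h hv.1
      simpa [hv.2] using this
    · intro h v hv
      by_cases hM : v ∈ M
      · simp [hM]
      · simpa [hM] using h ⟨hv, hM⟩
  rw [h1, mem_span_sq, sqMonomial_eq]
  constructor
  · intro h μ hμ
    obtain ⟨F, hF, hs⟩ := h (μ + sqExp M) (by
      rw [mem_support_iff, coeff_mul_monomial]; simpa using hμ)
    exact ⟨F, hF, (h2 F μ).1 hs⟩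
  · intro h ν hν
    rw [mem_support_iff, coeff_mul_monomial'] at hν
    split_ifs at hν with hle
    · obtain ⟨F, hF, hs⟩ := h (ν - sqExp M) (by rw [mem_support_iff]; simpa using hν)
      refine ⟨F, hF, ?_⟩
      have := (h2 F _).2 hs
      rwa [tsub_add_cancel_of_le hle] at this
    · exact absurd rfl hν

lemma supp_sqExp {V : Type} [DecidableEq V] (T : Finset V) : (sqExp T).support = T := by
  ext v; simp [sqExp_apply]

lemma colon_eq_iff (k : Type) {V : Type} [Field k] [DecidableEq V]
    (A : Set (Finset V)) (M : Finset V) (S : Set V) :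
    Submodule.colon (Ideal.span (sqMonomial k '' A)) (Ideal.span {sqMonomial k M}) =
        Ideal.span ((fun v => (X v : MvPolynomial V k)) '' S) ↔
      ∀ T : Finset V, (∃ F ∈ A, F \ M ⊆ T) ↔ ∃ v ∈ S, v ∈ T := by
  classical
  constructor
  · intro h T
    have := SetLike.ext_iff.1 h (monomial (sqExp T) 1)
    rw [mem_colon_sq, mem_ideal_span_X_image, support_monomial, if_neg one_ne_zero] at this
    simpa [supp_sqExp, sqExp_apply] using this
  · intro h
    ext f
    rw [mem_colon_sq, mem_ideal_span_X_image]
    refine forall₂_congr fun μ _ => ?_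
    rw [h]
    simp

lemma span_eq_iff (k : Type) {V : Type} [Field k] [DecidableEq V]
    (A B : Set (Finset V)) :
    Ideal.span (sqMonomial k '' A) = Ideal.span (sqMonomial k '' B) ↔
      ∀ T : Finset V, (∃ F ∈ A, F ⊆ T) ↔ ∃ F ∈ B, F ⊆ T := by
  classical
  constructor
  · intro h T
    have := SetLike.ext_iff.1 h (monomial (sqExp T) 1)
    rw [mem_span_sq, mem_span_sq, support_monomial, if_neg one_ne_zero] at this
    simpa [supp_sqExp] using this
  · intro h
    ext f
    rw [mem_span_sq, mem_span_sq]
    exact forall₂_congr fun μ _ => h _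

lemma hasLinearQuotients_iff (k : Type) {V : Type} [Field k] [Fintype V] [DecidableEq V]
    (G : SimpleGraph V) :
    HasLinearQuotients k (graphCliqueComplexIdeal k G) ↔
    ∃ (t : ℕ) (m : Fin t → Finset V),
    (∀ a b : Fin t, m a ⊆ m b → a = b) ∧
    (∀ T : Finset V, ¬ G.IsClique ↑T ↔ ∃ s, m s ⊆ T) ∧
    ∀ s : Fin t, ∃ S : Set V, ∀ T : Finset V,
      (∃ s' : Fin t, s' < s ∧ m s' \ m s ⊆ T) ↔ ∃ v ∈ S, v ∈ T := by
  unfold HasLinearQuotients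
  refine exists_congr fun t => exists_congr fun m => and_congr_right fun _ => and_congr ?_ ?_
  · have h1 : graphCliqueComplexIdeal k G =
        Ideal.span (sqMonomial k '' {F | ¬ G.IsClique ↑F}) := by
      unfold graphCliqueComplexIdeal
      congr 1
      ext p
      simp [eq_comm]
    have h2 : (Set.range fun s => sqMonomial k (m s)) = sqMonomial k '' (Set.range m) := by
      rw [← Set.range_comp]; rfl
    rw [h1, h2, span_eq_iff]
    refine forall_congr' fun T => ?_
    have h3 : (∃ F ∈ {F : Finset V | ¬ G.IsClique ↑F}, F ⊆ T) ↔ ¬ G.IsClique ↑T := by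
      constructor
      · rintro ⟨F, hF, hs⟩ hT
        exact hF (hT.subset (by exact_mod_cast hs))
      · intro h
        exact ⟨T, h, subset_rfl⟩
    rw [h3]
    simp
  · refine forall_congr' fun s => exists_congr fun S => ?_
    have h2 : {p | ∃ s' : Fin t, s' < s ∧ p = sqMonomial k (m s')} =
        sqMonomial k '' (m '' {s' | s' < s}) := by
      ext p
      simp [eq_comm]
    rw [h2, colon_eq_iff]
    simp

/-- `f 0, …, f (n-1)` is an induced cycle of `G`. -/
def IndCycle {V : Type} (G : SimpleGraph V) (n : ℕ) (f : ℕ → V) : Prop :=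
  ∀ i j, i < j → j < n → f i ≠ f j ∧ (G.Adj (f i) (f j) ↔ (j = i + 1 ∨ (i = 0 ∧ j + 1 = n)))

lemma cycleGraph_adj_lt {n : ℕ} (i j : Fin n) (h : i < j) :
    (SimpleGraph.cycleGraph n).Adj i j ↔
      ((j : ℕ) = i + 1 ∨ ((i : ℕ) = 0 ∧ (j : ℕ) + 1 = n)) := by
  have hi := i.2
  have hj := j.2
  have h' : (i : ℕ) < j := h
  rw [SimpleGraph.cycleGraph_adj', Fin.sub_val_of_le h.le, Fin.coe_sub_iff_lt.2 h]
  omega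

lemma isChordal_iff {V : Type} (G : SimpleGraph V) :
    G.IsChordal ↔ ∀ n f, 4 ≤ n → ¬ IndCycle G n f := by
  constructor
  · intro h n f hn hf
    refine (h n hn).false ⟨⟨fun i => f i, ?_⟩, ?_⟩
    · intro i j hij
      rcases lt_trichotomy i j with h | h | h
      · exact absurd hij (hf i j h j.2).1
      · exact h
      · exact absurd hij.symm (hf j i h i.2).1
    · intro i j
      change G.Adj (f i) (f j) ↔ _
      rcases lt_trichotomy i j with h | h | h
      · rw [cycleGraph_adj_lt i j h, (hf i j h j.2).2]
      · subst h; simp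
      · rw [SimpleGraph.adj_comm, SimpleGraph.adj_comm (SimpleGraph.cycleGraph n),
          cycleGraph_adj_lt j i h, (hf j i h i.2).2]
  · intro h n hn
    refine ⟨fun e => ?_⟩
    refine h n (fun i => if hi : i < n then e ⟨i, hi⟩ else e ⟨0, by omega⟩) hn ?_
    intro i j hij hj
    have hi : i < n := hij.trans hj
    simp only [hi, hj, dif_pos]
    constructor
    · intro heq
      have := e.injective heq
      simp at this; omega
    · rw [e.map_adj_iff, cycleGraph_adj_lt _ _ (by exact hij)]

/-- No weighted polygon. -/
lemma no_polygon {V : Type} (w : V → V → ℕ) (t : ℕ)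
    (hsymm : ∀ a b, w a b = w b a)
    (hinj : ∀ a b c d, w a b = w c d → w a b < t → (a = c ∧ b = d) ∨ (a = d ∧ b = c))
    (hlq : ∀ a b c d, a ≠ b → a ≠ c → a ≠ d → b ≠ c → b ≠ d → c ≠ d → w a b < t →
      w c d < w a b → w a c < w a b ∨ w a d < w a b ∨ w b c < w a b ∨ w b d < w a b) :
    ∀ n, 4 ≤ n → ∀ (f : ℕ → V) (θ : ℕ), θ ≤ t →
      (∀ i j, i < j → j < n → f i ≠ f j) →
      (∀ i, i + 1 < n → θ ≤ w (f i) (f (i + 1))) →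
      θ ≤ w (f 0) (f (n - 1)) →
      (∀ i j, i + 1 < j → j < n → ¬ (i = 0 ∧ j + 1 = n) → w (f i) (f j) < θ) → False := by
  intro n
  induction n using Nat.strong_induction_on with
  | _ n ih =>
  intro hn f θ hθ hne hcons hend hch
  -- the heaviest chord
  obtain ⟨⟨i, j⟩, hmem, hmax⟩ := Finset.exists_max_image
    (((Finset.range n) ×ˢ (Finset.range n)).filter
      (fun p => p.1 + 1 < p.2 ∧ ¬ (p.1 = 0 ∧ p.2 + 1 = n))) (fun p => w (f p.1) (f p.2))
    ⟨(0, 2), by simp; omega⟩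
  simp only [Finset.mem_filter, Finset.mem_product, Finset.mem_range] at hmem hmax
  obtain ⟨⟨hi, hj⟩, hij, hnb⟩ := hmem
  have hlt : w (f i) (f j) < θ := hch i j hij hj hnb
  have hstrict : ∀ p q, p + 1 < q → q < n → ¬ (p = 0 ∧ q + 1 = n) → ¬ (p = i ∧ q = j) →
      w (f p) (f q) < w (f i) (f j) := by
    intro p q hpq hq hb hne'
    have hle : w (f p) (f q) ≤ w (f i) (f j) := hmax (p, q) ⟨⟨by omega, hq⟩, hpq, hb⟩
    refine lt_of_le_of_ne hle fun heq => ?_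
    have hinjf : ∀ a b, a < n → b < n → f a = f b → a = b := by
      intro a b ha hb hab
      rcases lt_trichotomy a b with h | h | h
      · exact absurd hab (hne a b h hb)
      · exact h
      · exact absurd hab.symm (hne b a h ha)
    rcases hinj _ _ _ _ heq (by omega) with ⟨h1, h2⟩ | ⟨h1, h2⟩
    · exact hne' ⟨hinjf _ _ (by omega) hi h1, hinjf _ _ hq hj h2⟩
    · have := hinjf _ _ (by omega) hj h1
      have := hinjf _ _ hq hi h2
      omega
  by_cases h1 : 4 ≤ j - i + 1
  · refine ih (j - i + 1) (by omega) h1 (fun k => f (i + k)) (w (f i) (f j)) (by omega) ?_ ?_ ?_ ?_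
    · intro a b hab hb
      exact hne _ _ (by omega) (by omega)
    · intro a ha
      have := hcons (i + a) (by omega)
      rw [add_assoc] at this
      omega
    · simp only [add_zero]
      rw [show i + (j - i + 1 - 1) = j by omega]
    · intro a b hab hb hnb'
      exact hstrict _ _ (by omega) (by omega) (by omega) (by omega)
  by_cases h2 : 4 ≤ n - (j - i - 1)
  · have hj2 : j = i + 2 := by omega
    subst hj2
    refine ih (n - 1) (by omega) (by omega) (fun k => if k ≤ i then f k else f (k + 1))
      (w (f i) (f (i + 2))) (by omega) ?_ ?_ ?_ ?_
    · intro a b hab hb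
      try dsimp only
      split_ifs <;> first | exact hne _ _ (by omega) (by omega) | omega
    · intro a ha
      try dsimp only
      by_cases hai : a = i
      · subst hai
        simp
      · split_ifs
        · have := hcons a (by omega); omega
        · omega
        · omega
        · have := hcons (a + 1) (by omega); omega
    · try dsimp only
      rw [if_pos (by omega), if_neg (by omega), show n - 1 - 1 + 1 = n - 1 by omega]
      omega
    · intro a b hab hb hnb'
      try dsimp only
      split_ifs <;> first | exact hstrict _ _ (by omega) (by omega) (by omega) (by omega) | omega
  have hn4 : n = 4 := by omega
  have hj2 : j = i + 2 := by omega
  subst hn4 hj2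
  have e01 := hcons 0 (by omega)
  have e12 := hcons 1 (by omega)
  have e23 := hcons 2 (by omega)
  simp only [zero_add, Nat.reduceAdd, Nat.add_one_sub_one] at e01 e12 e23 hend
  have s12 := hsymm (f 1) (f 2)
  have s01 := hsymm (f 0) (f 1)
  have s23 := hsymm (f 2) (f 3)
  have s03 := hsymm (f 0) (f 3)
  have n01 := hne 0 1 (by omega) (by omega)
  have n02 := hne 0 2 (by omega) (by omega)
  have n03 := hne 0 3 (by omega) (by omega)
  have n12 := hne 1 2 (by omega) (by omega)
  have n13 := hne 1 3 (by omega) (by omega)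
  have n23 := hne 2 3 (by omega) (by omega)
  have hi01 : i = 0 ∨ i = 1 := by omega
  rcases hi01 with rfl | rfl
  · have hs := hstrict 1 3 (by omega) (by omega) (by omega) (by omega)
    simp only [zero_add] at *
    have := hlq (f 0) (f 2) (f 1) (f 3) n02 n01 n03 n12.symm n23 n13 (by omega) hs
    omega
  · have hs := hstrict 0 2 (by omega) (by omega) (by omega) (by omega)
    simp only [Nat.reduceAdd] at *
    have := hlq (f 1) (f 3) (f 0) (f 2) n13 n01.symm n12 n03.symm n23.symm n02 (by omega) hs
    omega

lemma chordal_of_lq {V : Type} [DecidableEq V] (G : SimpleGraph V)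
    (t : ℕ) (m : Fin t → Finset V)
    (hanti : ∀ a b : Fin t, m a ⊆ m b → a = b)
    (hgen : ∀ T : Finset V, ¬ G.IsClique ↑T ↔ ∃ s, m s ⊆ T)
    (hS : ∀ s : Fin t, ∃ S : Set V, ∀ T : Finset V,
      (∃ s' : Fin t, s' < s ∧ m s' \ m s ⊆ T) ↔ ∃ v ∈ S, v ∈ T) : G.IsChordal := by
  classical
  rw [isChordal_iff]
  intro n f hn hf
  have hmne : ∀ s, ¬ G.IsClique ↑(m s) := fun s => (hgen _).2 ⟨s, subset_rfl⟩
  have hpairne : ∀ a b, a ≠ b → ¬ G.Adj a b → ∃ s, m s = {a, b} := by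
    intro a b hab hadj
    have hnc : ¬ G.IsClique ↑({a, b} : Finset V) := by
      intro hc
      exact hadj (hc (by simp) (by simp) hab)
    obtain ⟨s, hs⟩ := (hgen _).1 hnc
    refine ⟨s, hs.antisymm ?_⟩
    by_contra hcon
    apply hmne s
    intro x hx y hy hxy
    exfalso
    apply hcon
    have hx' := hs hx
    have hy' := hs hy
    simp only [Finset.mem_insert, Finset.mem_singleton] at hx' hy'
    intro z hz
    simp only [Finset.mem_insert, Finset.mem_singleton] at hz
    simp only [Finset.mem_coe] at hx hy
    grind
  have hpair : ∀ s, ∃ a b, a ≠ b ∧ ¬ G.Adj a b ∧ m s = {a, b} := by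
    intro s
    have := hmne s
    simp only [SimpleGraph.isClique_iff, Set.Pairwise] at this
    push Not at this
    obtain ⟨a, ha, b, hb, hab, hadj⟩ := this
    obtain ⟨s', hs'⟩ := hpairne a b hab hadj
    have : s' = s := hanti _ _ (by
      rw [hs']; intro z hz; simp at hz; rcases hz with rfl | rfl <;> assumption)
    subst this
    exact ⟨a, b, hab, hadj, hs'⟩
  let w : V → V → ℕ := fun a b => if h : ∃ s, m s = {a, b} then (h.choose : ℕ) else t
  have hw : ∀ a b s, m s = {a, b} → w a b = s := by
    intro a b s h
    have hex : ∃ s, m s = {a, b} := ⟨s, h⟩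
    simp only [w, dif_pos hex]
    rw [hanti hex.choose s (by rw [hex.choose_spec, h])]
  have hwlt : ∀ a b, w a b < t → ∃ s, m s = {a, b} ∧ w a b = s := by
    intro a b h
    by_cases hex : ∃ s, m s = {a, b}
    · exact ⟨_, hex.choose_spec, hw _ _ _ hex.choose_spec⟩
    · simp [w, dif_neg hex] at h
  have hwadj : ∀ a b, G.Adj a b → w a b = t := by
    intro a b hab
    have : ¬ ∃ s, m s = {a, b} := by
      rintro ⟨s, hs⟩
      apply hmne s
      rw [hs]
      simp [hab]
    simp [w, dif_neg this]
  refine no_polygon w t ?_ ?_ ?_ n hn f t le_rfl ?_ ?_ ?_ ?_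
  · intro a b
    simp only [w, Finset.pair_comm a b]
  · intro a b c d heq hlt
    obtain ⟨s, hs, hs2⟩ := hwlt a b hlt
    obtain ⟨s', hs', hs2'⟩ := hwlt c d (by omega)
    have : s = s' := Fin.ext (by omega)
    subst this
    have hset : ({a, b} : Finset V) = {c, d} := hs.symm.trans hs'
    have ha : a ∈ ({c, d} : Finset V) := hset ▸ (by simp)
    have hb : b ∈ ({c, d} : Finset V) := hset ▸ (by simp)
    have hc : c ∈ ({a, b} : Finset V) := hset ▸ (by simp)
    have hd : d ∈ ({a, b} : Finset V) := hset ▸ (by simp)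
    simp only [Finset.mem_insert, Finset.mem_singleton] at ha hb hc hd
    grind
  · intro a b c d hab hac had hbc hbd hcd hlt hlt2
    obtain ⟨s, hs, hs2⟩ := hwlt a b hlt
    obtain ⟨s', hs', hs2'⟩ := hwlt c d (by omega)
    obtain ⟨S, hS⟩ := hS s
    obtain ⟨v, hvS, hv⟩ := (hS (m s' \ m s)).1 ⟨s', by rw [Fin.lt_def]; omega, subset_rfl⟩
    obtain ⟨r, hr, hrs⟩ := (hS {v}).2 ⟨v, hvS, by simp⟩
    obtain ⟨x, y, hxy, -, hm⟩ := hpair r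
    have hrv : (r : ℕ) < w a b := by rw [hs2]; exact hr
    have hvr : ∃ z ∈ m r, z ∉ m s := by
      by_contra hcon
      push Not at hcon
      exact hr.ne (hanti _ _ hcon)
    obtain ⟨z, hz, hzs⟩ := hvr
    have hzv : z = v := by simpa using hrs (Finset.mem_sdiff.2 ⟨hz, hzs⟩)
    subst hzv
    rw [hs', hs] at hv
    simp only [Finset.mem_sdiff, Finset.mem_insert, Finset.mem_singleton, not_or] at hv
    -- m r = {z, u} with u ∈ {a, b}
    have hu : m r = {a, z} ∨ m r = {b, z} := by
      have key : ∀ u, u ∈ m r → u ≠ z → u = a ∨ u = b := by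
        intro u hu huz
        by_contra hcon
        apply huz
        have : u ∈ m r \ m s := by
          rw [Finset.mem_sdiff, hs]
          simp only [Finset.mem_insert, Finset.mem_singleton]
          exact ⟨hu, hcon⟩
        simpa using hrs this
      rw [hm] at hz key ⊢
      simp only [Finset.mem_insert, Finset.mem_singleton] at hz key
      rcases hz with rfl | rfl
      · rcases key y (by simp) hxy.symm with rfl | rfl
        · left; exact Finset.pair_comm _ _
        · right; exact Finset.pair_comm _ _
      · rcases key x (by simp) hxy with rfl | rfl
        · left; rfl
        · right; rfl
    rcases hv.1 with rfl | rfl <;> rcases hu with hu | hu <;> have := hw _ _ _ hu <;> omega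
  · intro i j hij hj
    exact (hf i j hij hj).1
  · intro i hi
    exact (hwadj _ _ ((hf i (i+1) (by omega) hi).2.2 (Or.inl rfl))).ge
  · exact (hwadj _ _ ((hf 0 (n-1) (by omega) (by omega)).2.2 (Or.inr ⟨rfl, by omega⟩))).ge
  · intro i j hij hj hnb
    obtain ⟨s, hs⟩ := hpairne _ _ (hf i j (by omega) hj).1
      (fun h => by have := (hf i j (by omega) hj).2.1 h; omega)
    rw [hw _ _ _ hs]
    exact s.2

/-- `f` is a walk of length `n` from `x` to `y` inside `W`. -/
def SeqWalk {V : Type} (G : SimpleGraph V) (W : Set V) (x y : V) (n : ℕ) (f : ℕ → V) : Prop :=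
  f 0 = x ∧ f n = y ∧ (∀ i, i ≤ n → f i ∈ W) ∧ ∀ i, i < n → G.Adj (f i) (f (i + 1))

lemma exists_seqWalk {V : Type} (G : SimpleGraph V) (W : Set V) (x y : V) (hx : x ∈ W)
    (h : Relation.ReflTransGen (fun a b => G.Adj a b ∧ a ∈ W ∧ b ∈ W) x y) :
    ∃ n f, SeqWalk G W x y n f := by
  induction h with
  | refl => exact ⟨0, fun _ => x, rfl, rfl, fun _ _ => hx, by simp⟩
  | @tail b c _ hbc ih =>
    obtain ⟨n, f, h0, hn, hW, hadj⟩ := ih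
    refine ⟨n + 1, fun i => if i ≤ n then f i else c, by simp [h0], by simp, ?_, ?_⟩
    · intro i hi
      dsimp only
      split_ifs with h
      · exact hW i h
      · exact hbc.2.2
    · intro i hi
      dsimp only
      rw [if_pos (by omega)]
      split_ifs with h
      · exact hadj i h
      · rw [show i = n by omega, hn]; exact hbc.1

lemma exists_induced_seqWalk {V : Type} (G : SimpleGraph V) (W : Set V) (x y : V)
    (h : ∃ n f, SeqWalk G W x y n f) :
    ∃ n f, SeqWalk G W x y n f ∧
      ∀ i j, i < j → j ≤ n → f i ≠ f j ∧ (G.Adj (f i) (f j) ↔ j = i + 1) := by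
  classical
  obtain ⟨f, hf⟩ := Nat.find_spec h
  have hmin : ∀ m, (∃ f, SeqWalk G W x y m f) → Nat.find h ≤ m := fun m hm => Nat.find_min' h hm
  generalize Nat.find h = n at hf hmin
  refine ⟨n, f, hf, ?_⟩
  obtain ⟨h0, hn, hW, hadj⟩ := hf
  intro i j hij hj
  constructor
  · intro heq
    have := hmin (n - (j - i)) ⟨fun k => if k ≤ i then f k else f (k + (j - i)), ?_⟩
    · omega
    refine ⟨by simp [h0], ?_, ?_, ?_⟩
    · dsimp only
      split_ifs with hh
      · rw [show n - (j - i) = i by omega, heq, show j = n by omega, hn]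
      · rw [show n - (j - i) + (j - i) = n by omega, hn]
    · intro k hk
      dsimp only
      split_ifs <;> exact hW _ (by omega)
    · intro k hk
      dsimp only
      by_cases hki : k = i
      · subst hki
        rw [if_pos le_rfl, if_neg (by omega), heq, show k + 1 + (j - k) = j + 1 by omega]
        exact hadj _ (by omega)
      · split_ifs
        · exact hadj _ (by omega)
        · omega
        · omega
        · rw [show k + 1 + (j - i) = k + (j - i) + 1 by omega]
          exact hadj _ (by omega)
  · constructor
    · intro hA
      by_contra hne
      have := hmin (n - (j - i - 1)) ⟨fun k => if k ≤ i then f k else f (k + (j - i - 1)), ?_⟩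
      · omega
      refine ⟨by simp [h0], ?_, ?_, ?_⟩
      · dsimp only
        rw [if_neg (by omega), show n - (j - i - 1) + (j - i - 1) = n by omega, hn]
      · intro k hk
        dsimp only
        split_ifs <;> exact hW _ (by omega)
      · intro k hk
        dsimp only
        by_cases hki : k = i
        · subst hki
          rw [if_pos le_rfl, if_neg (by omega), show k + 1 + (j - k - 1) = j by omega]
          exact hA
        · split_ifs
          · exact hadj _ (by omega)
          · omega
          · omega
          · rw [show k + 1 + (j - i - 1) = k + (j - i - 1) + 1 by omega]
            exact hadj _ (by omega)
    · rintro rfl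
      exact hadj _ (by omega)

/-- `w` is simplicial in the subgraph induced on `U`. -/
def Simplicial {V : Type} (G : SimpleGraph V) (U : Finset V) (w : V) : Prop :=
  w ∈ U ∧ ∀ a ∈ U, ∀ b ∈ U, G.Adj w a → G.Adj w b → a ≠ b → G.Adj a b

/-- Two neighbours of `v` joined through a connected set away from `v` are adjacent. -/
lemma adj_of_sep {V : Type} (G : SimpleGraph V) (hG : G.IsChordal) (C : Set V) (v x y : V)
    (hvC : v ∉ C) (hCv : ∀ c ∈ C, ¬ G.Adj v c) (hvx : G.Adj v x) (hvy : G.Adj v y) (hxy : x ≠ y)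
    (h : ∃ n f, SeqWalk G (C ∪ {x, y}) x y n f) : G.Adj x y := by
  by_contra hna
  obtain ⟨n, f, ⟨h0, hn, hW, hadj⟩, hind⟩ := exists_induced_seqWalk G _ x y h
  have hn2 : 2 ≤ n := by
    rcases n with _ | _ | n
    · exact absurd (h0.symm.trans hn) hxy
    · have := hadj 0 (by omega)
      simp only [zero_add] at this hn
      rw [h0, hn] at this
      exact absurd this hna
    · omega
  have hinterior : ∀ i, 0 < i → i < n → f i ∈ C := by
    intro i hi hin
    rcases hW i hin.le with h | h | h
    · exact h
    · exact absurd (h0.trans h.symm) (hind 0 i hi hin.le).1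
    · exact absurd (Eq.trans h hn.symm) (hind i n hin le_rfl).1
  refine (isChordal_iff G).1 hG (n + 2) (fun i => if i ≤ n then f i else v) (by omega) ?_
  intro i j hij hj
  dsimp only
  rw [if_pos (by omega : i ≤ n)]
  split_ifs with hjn
  · refine ⟨(hind i j hij hjn).1, ?_⟩
    rw [(hind i j hij hjn).2]
    omega
  · have hj' : j = n + 1 := by omega
    subst hj'
    rcases Nat.eq_zero_or_pos i with rfl | hi
    · rw [h0]
      exact ⟨hvx.ne', by simp [hvx.symm]⟩
    · by_cases hin : i = n
      · subst hin
        rw [hn]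
        exact ⟨hvy.ne', by simp [hvy.symm]⟩
      · have hc := hinterior i hi (by omega)
        refine ⟨fun he => hvC (he ▸ hc), ?_⟩
        constructor
        · intro ha
          exact absurd ha.symm (hCv _ hc)
        · omega

lemma dirac {V : Type} [DecidableEq V] (G : SimpleGraph V) (hG : G.IsChordal) :
    ∀ (N : ℕ) (U : Finset V), U.card = N → ∀ v ∈ U, (∃ u ∈ U, u ≠ v ∧ ¬ G.Adj v u) →
      ∃ w, Simplicial G U w ∧ w ≠ v ∧ ¬ G.Adj v w := by
  classical
  intro N
  induction N using Nat.strong_induction_on with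
  | _ N ih =>
  intro U hUN v hv ⟨c0, hc0, hc0v, hc0a⟩
  -- every smaller nonempty set has a simplicial vertex
  have ihs : ∀ U' : Finset V, U'.card < N → U'.Nonempty → ∃ w, Simplicial G U' w := by
    intro U' hcard ⟨z, hz⟩
    by_cases hcl : ∃ a ∈ U', ∃ u ∈ U', u ≠ a ∧ ¬ G.Adj a u
    · obtain ⟨a, ha, hu⟩ := hcl
      obtain ⟨w, hw, -⟩ := ih _ hcard U' rfl a ha hu
      exact ⟨w, hw⟩
    · push Not at hcl
      exact ⟨z, hz, fun a ha b hb _ _ hab => hcl a ha b hb hab.symm⟩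
  let R : V → V → Prop := fun a b => G.Adj a b ∧ (a ∈ U ∧ a ≠ v ∧ ¬ G.Adj v a) ∧
    (b ∈ U ∧ b ≠ v ∧ ¬ G.Adj v b)
  let C : Finset V := U.filter (fun c => Relation.ReflTransGen R c0 c)
  have hCM : ∀ c ∈ C, c ∈ U ∧ c ≠ v ∧ ¬ G.Adj v c := by
    intro c hc
    have hc' := (Finset.mem_filter.1 hc).2
    rcases Relation.ReflTransGen.cases_tail hc' with h | ⟨b, _, h⟩
    · subst h; exact ⟨hc0, hc0v, hc0a⟩
    · exact h.2.2
  have hc0C : c0 ∈ C := Finset.mem_filter.2 ⟨hc0, Relation.ReflTransGen.refl⟩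
  -- neighbours of C
  have hnb : ∀ c ∈ C, ∀ u ∈ U, G.Adj c u → u ∉ C → G.Adj v u := by
    intro c hc u hu hadj huC
    by_contra hvu
    apply huC
    have hcM := hCM c hc
    refine Finset.mem_filter.2 ⟨hu, (Finset.mem_filter.1 hc).2.tail ⟨hadj, hcM, hu, ?_, hvu⟩⟩
    rintro rfl
    exact hcM.2.2 hadj.symm
  let S : Finset V := U.filter (fun u => u ∉ C ∧ ∃ c ∈ C, G.Adj c u)
  have hSv : ∀ x ∈ S, G.Adj v x := by
    intro x hx
    obtain ⟨hxU, hxC, c, hc, hcx⟩ := Finset.mem_filter.1 hx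
    exact hnb c hc x hxU hcx hxC
  have hScl : ∀ x ∈ S, ∀ y ∈ S, x ≠ y → G.Adj x y := by
    intro x hx y hy hxy
    refine adj_of_sep G hG (C : Set V) v x y (fun h => (hCM v h).2.1 rfl)
      (fun c hc => (hCM c hc).2.2) (hSv x hx) (hSv y hy) hxy ?_
    apply exists_seqWalk
    · simp
    obtain ⟨hxU, hxC, c, hc, hcx⟩ := Finset.mem_filter.1 hx
    obtain ⟨hyU, hyC, d, hd, hdy⟩ := Finset.mem_filter.1 hy
    have hconn : ∀ c, Relation.ReflTransGen R c0 c → Relation.ReflTransGen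
        (fun a b => G.Adj a b ∧ a ∈ ((C : Set V) ∪ {x, y}) ∧ b ∈ ((C : Set V) ∪ {x, y})) c0 c := by
      intro c hc
      induction hc with
      | refl => exact Relation.ReflTransGen.refl
      | @tail b e hb hbe ih2 =>
        refine ih2.tail ⟨hbe.1, Or.inl ?_, Or.inl ?_⟩
        · exact Finset.mem_coe.2 (Finset.mem_filter.2 ⟨hbe.2.1.1, hb⟩)
        · exact Finset.mem_coe.2 (Finset.mem_filter.2 ⟨hbe.2.2.1, hb.tail hbe⟩)
    have hsymm : Std.Symm (fun a b => G.Adj a b ∧ a ∈ ((C : Set V) ∪ {x, y}) ∧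
        b ∈ ((C : Set V) ∪ {x, y})) := ⟨fun a b h => ⟨h.1.symm, h.2.2, h.2.1⟩⟩
    have h1 := Relation.ReflTransGen.stdSymm.symm _ _ (hconn c (Finset.mem_filter.1 hc).2)
    have h2 := hconn d (Finset.mem_filter.1 hd).2
    refine Relation.ReflTransGen.head ⟨hcx.symm, by simp, Or.inl hc⟩ ?_
    exact (h1.trans h2).tail ⟨hdy, Or.inl hd, by simp⟩
  have hsub : C ∪ S ⊆ U.erase v := by
    intro z hz
    rcases Finset.mem_union.1 hz with h | h
    · exact Finset.mem_erase.2 ⟨(hCM z h).2.1, (hCM z h).1⟩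
    · exact Finset.mem_erase.2 ⟨(hSv z h).ne', (Finset.mem_filter.1 h).1⟩
  have hcard : (C ∪ S).card < N := by
    have := Finset.card_le_card hsub
    have := Finset.card_erase_lt_of_mem hv
    omega
  -- it suffices to find a vertex of C simplicial in C ∪ S
  suffices hsuff : ∃ w ∈ C, Simplicial G (C ∪ S) w by
    obtain ⟨w, hwC, hw⟩ := hsuff
    have hin : ∀ a ∈ U, G.Adj w a → a ∈ C ∪ S := by
      intro a ha hwa
      by_cases haC : a ∈ C
      · exact Finset.mem_union_left _ haC
      · exact Finset.mem_union_right _ (Finset.mem_filter.2 ⟨ha, haC, w, hwC, hwa⟩)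
    exact ⟨w, ⟨(hCM w hwC).1, fun a ha b hb hwa hwb hab =>
      hw.2 a (hin a ha hwa) b (hin b hb hwb) hwa hwb hab⟩, (hCM w hwC).2⟩
  by_cases huniv : ∃ s ∈ S, ∃ u ∈ C ∪ S, u ≠ s ∧ ¬ G.Adj s u
  · obtain ⟨s, hs, hu⟩ := huniv
    obtain ⟨w, hw, hws, hwa⟩ := ih _ hcard (C ∪ S) rfl s (Finset.mem_union_right _ hs) hu
    refine ⟨w, ?_, hw⟩
    rcases Finset.mem_union.1 hw.1 with h | h
    · exact h
    · exact absurd (hScl s hs w h hws.symm) hwa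
  · push Not at huniv
    obtain ⟨w, hw⟩ := ihs C (lt_of_le_of_lt (Finset.card_le_card Finset.subset_union_left) hcard)
      ⟨c0, hc0C⟩
    refine ⟨w, hw.1, Finset.mem_union_left _ hw.1, ?_⟩
    intro a ha b hb hwa hwb hab
    by_cases haS : a ∈ S
    · exact huniv a haS b hb hab.symm
    by_cases hbS : b ∈ S
    · exact (huniv b hbS a ha hab).symm
    have haC : a ∈ C := (Finset.mem_union.1 ha).resolve_right haS
    have hbC : b ∈ C := (Finset.mem_union.1 hb).resolve_right hbS
    exact hw.2 a haC b hbC hwa hwb hab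

lemma exists_peo {V : Type} [DecidableEq V] (G : SimpleGraph V) (hG : G.IsChordal)
    (U : Finset V) : ∃ key : V → ℕ, (∀ a ∈ U, ∀ b ∈ U, key a = key b → a = b) ∧
      ∀ p ∈ U, ∀ a ∈ U, ∀ b ∈ U, key p < key a → key p < key b → G.Adj p a → G.Adj p b →
        a ≠ b → G.Adj a b := by
  induction U using Finset.strongInduction with
  | H U ih =>
  rcases U.eq_empty_or_nonempty with rfl | hne
  · exact ⟨fun _ => 0, by simp, by simp⟩
  have hsimp : ∃ w, Simplicial G U w := by
    obtain ⟨z, hz⟩ := hne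
    by_cases hcl : ∃ a ∈ U, ∃ u ∈ U, u ≠ a ∧ ¬ G.Adj a u
    · obtain ⟨a, ha, hu⟩ := hcl
      obtain ⟨w, hw, -⟩ := dirac G hG _ U rfl a ha hu
      exact ⟨w, hw⟩
    · push Not at hcl
      exact ⟨z, hz, fun a ha b hb _ _ hab => hcl a ha b hb hab.symm⟩
  obtain ⟨w, hwU, hw⟩ := hsimp
  obtain ⟨key, hinj, hpeo⟩ := ih (U.erase w) (Finset.erase_ssubset hwU)
  refine ⟨fun z => if z = w then 0 else key z + 1, ?_, ?_⟩
  · intro a ha b hb hab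
    dsimp only at hab
    split_ifs at hab with h1 h2 h2
    · exact h1.trans h2.symm
    · exact hinj a (Finset.mem_erase.2 ⟨h1, ha⟩) b (Finset.mem_erase.2 ⟨h2, hb⟩) (by omega)
  · intro p hp a ha b hb hpa hpb hadja hadjb hab
    dsimp only at hpa hpb
    by_cases hpw : p = w
    · subst hpw
      exact hw a ha b hb hadja hadjb hab
    · rw [if_neg hpw] at hpa hpb
      have h1 : a ≠ w := by rintro rfl; simp at hpa
      have h2 : b ≠ w := by rintro rfl; simp at hpb
      rw [if_neg h1] at hpa
      rw [if_neg h2] at hpb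
      exact hpeo p (Finset.mem_erase.2 ⟨hpw, hp⟩) a (Finset.mem_erase.2 ⟨h1, ha⟩) b
        (Finset.mem_erase.2 ⟨h2, hb⟩) (by omega) (by omega) hadja hadjb hab


lemma lq_of_chordal {V : Type} [Fintype V] [DecidableEq V] (G : SimpleGraph V)
    (hG : G.IsChordal) :
    ∃ (t : ℕ) (m : Fin t → Finset V),
    (∀ a b : Fin t, m a ⊆ m b → a = b) ∧
    (∀ T : Finset V, ¬ G.IsClique ↑T ↔ ∃ s, m s ⊆ T) ∧
    ∀ s : Fin t, ∃ S : Set V, ∀ T : Finset V,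
      (∃ s' : Fin t, s' < s ∧ m s' \ m s ⊆ T) ↔ ∃ v ∈ S, v ∈ T := by
  classical
  obtain ⟨key, hinj', hpeo'⟩ := exists_peo G hG Finset.univ
  have hinj : ∀ a b, key a = key b → a = b := fun a b => hinj' a (by simp) b (by simp)
  have hpeo : ∀ p a b, key p < key a → key p < key b → G.Adj p a → G.Adj p b →
      a ≠ b → G.Adj a b := fun p a b => hpeo' p (by simp) a (by simp) b (by simp)
  let P : Finset (Finset V) := Finset.univ.filter
    (fun F => ∃ a b, a ≠ b ∧ ¬ G.Adj a b ∧ F = {a, b})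
  let mk : Finset V → ℕ := fun F => sInf (key '' (F : Set V))
  have hmk : ∀ a b, key a < key b → mk {a, b} = key a := by
    intro a b hab
    apply le_antisymm
    · exact Nat.sInf_le ⟨a, by simp, rfl⟩
    · refine le_csInf ⟨key a, a, by simp, rfl⟩ ?_
      rintro _ ⟨z, hz, rfl⟩
      simp only [Finset.coe_insert, Finset.coe_singleton, Set.mem_insert_iff,
        Set.mem_singleton_iff] at hz
      rcases hz with rfl | rfl <;> omega
  let e := P.equivFin.symm
  let g : Fin P.card → ℕ := fun i => mk (e i)
  let σ := Tuple.sort g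
  have hmono : Monotone (g ∘ σ) := Tuple.monotone_sort g
  let m : Fin P.card → Finset V := fun i => e (σ i)
  have hmmono : ∀ a b, a ≤ b → mk (m a) ≤ mk (m b) := fun a b hab => hmono hab
  have hminj : ∀ a b, m a = m b → a = b := by
    intro a b hab
    exact σ.injective (e.injective (Subtype.ext hab))
  have hmP : ∀ s, ∃ a b, key a < key b ∧ ¬ G.Adj a b ∧ m s = {a, b} := by
    intro s
    obtain ⟨a, b, hab, hadj, h⟩ := (Finset.mem_filter.1 (e (σ s)).2).2
    rcases lt_trichotomy (key a) (key b) with hk | hk | hk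
    · exact ⟨a, b, hk, hadj, h⟩
    · exact absurd (hinj _ _ hk) hab
    · exact ⟨b, a, hk, fun h => hadj h.symm, by rw [Finset.pair_comm]; exact h⟩
  have hPm : ∀ a b, a ≠ b → ¬ G.Adj a b → ∃ s, m s = {a, b} := by
    intro a b hab hadj
    have hin : ({a, b} : Finset V) ∈ P :=
      Finset.mem_filter.2 ⟨Finset.mem_univ _, a, b, hab, hadj, rfl⟩
    exact ⟨σ.symm (e.symm ⟨_, hin⟩), by simp [m]⟩
  have hcard : ∀ s, (m s).card = 2 := by
    intro s
    obtain ⟨a, b, hab, -, h⟩ := hmP s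
    rw [h]
    exact Finset.card_pair (by rintro rfl; omega)
  have hanti : ∀ a b, m a ⊆ m b → a = b := fun a b hab =>
    hminj a b (Finset.eq_of_subset_of_card_le hab (by rw [hcard, hcard]))
  refine ⟨P.card, m, hanti, ?_, ?_⟩
  · intro T
    constructor
    · intro h
      simp only [SimpleGraph.isClique_iff, Set.Pairwise] at h
      push Not at h
      obtain ⟨a, ha, b, hb, hab, hadj⟩ := h
      obtain ⟨s, hs⟩ := hPm a b hab hadj
      refine ⟨s, ?_⟩
      rw [hs]
      intro z hz
      simp only [Finset.mem_insert, Finset.mem_singleton] at hz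
      rcases hz with rfl | rfl <;> assumption
    · rintro ⟨s, hs⟩ hcl
      obtain ⟨a, b, hab, hadj, h⟩ := hmP s
      rw [h] at hs
      exact hadj (hcl (hs (by simp)) (hs (by simp)) (by rintro rfl; omega))
  · intro s
    refine ⟨{v | ∃ r, r < s ∧ m r \ m s = {v}}, fun T => ?_⟩
    constructor
    · rintro ⟨s', hs', hT⟩
      suffices h : ∃ v ∈ m s' \ m s, ∃ r, r < s ∧ m r \ m s = {v} by
        obtain ⟨v, hv, hr⟩ := h
        exact ⟨v, hr, hT hv⟩
      obtain ⟨p, q, hpq, hpqa, hm'⟩ := hmP s'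
      obtain ⟨i, j, hij, hija, hm⟩ := hmP s
      by_cases hp : p ∈ m s
      · have hq : q ∉ m s := by
          intro hq
          refine hs'.ne (hanti _ _ ?_)
          rw [hm']
          intro z hz
          simp only [Finset.mem_insert, Finset.mem_singleton] at hz
          rcases hz with rfl | rfl <;> assumption
        refine ⟨q, Finset.mem_sdiff.2 ⟨by rw [hm']; simp, hq⟩, s', hs', ?_⟩
        rw [hm']
        ext z
        simp only [Finset.mem_sdiff, Finset.mem_insert, Finset.mem_singleton]
        grind
      have hpin : p ∈ m s' \ m s := Finset.mem_sdiff.2 ⟨by rw [hm']; simp, hp⟩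
      refine ⟨p, hpin, ?_⟩
      by_cases hq : q ∈ m s
      · refine ⟨s', hs', ?_⟩
        rw [hm']
        ext z
        simp only [Finset.mem_sdiff, Finset.mem_insert, Finset.mem_singleton]
        grind
      have hpi : key p < key i := by
        have h1 := hmmono s' s hs'.le
        rw [hm', hm, hmk _ _ hpq, hmk _ _ hij] at h1
        refine lt_of_le_of_ne h1 fun h => hp ?_
        rw [hinj _ _ h, hm]; simp
      have hex : ∃ u ∈ m s, key p < key u ∧ ¬ G.Adj p u := by
        by_contra hcon
        push Not at hcon
        rw [hm] at hcon
        exact hija (hpeo p i j hpi (by omega) (hcon i (by simp) hpi)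
          (hcon j (by simp) (by omega)) (by rintro rfl; omega))
      obtain ⟨u, hu, hpu, hadj⟩ := hex
      obtain ⟨r, hr⟩ := hPm p u (by rintro rfl; omega) hadj
      refine ⟨r, ?_, ?_⟩
      · by_contra hle
        have h1 := hmmono s r (not_lt.1 hle)
        rw [hr, hm, hmk _ _ hpu, hmk _ _ hij] at h1
        omega
      · rw [hr]
        ext z
        simp only [Finset.mem_sdiff, Finset.mem_insert, Finset.mem_singleton]
        grind
    · rintro ⟨v, ⟨r, hr, hrv⟩, hv⟩
      exact ⟨r, hr, by rw [hrv]; simpa using hv⟩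

/-- A finite simple graph `G` is chordal if and only if the
Stanley–Reisner ideal `I_{Δ(G)}` of the clique complex of `G` has linear quotients. -/
theorem chordal_iff_linearQuotients (k V : Type) [Field k] [Fintype V] [DecidableEq V]
    (G : SimpleGraph V) :
    G.IsChordal ↔ HasLinearQuotients k (graphCliqueComplexIdeal k G) := by
  rw [hasLinearQuotients_iff]
  constructor
  · exact lq_of_chordal G
  · rintro ⟨t, m, h1, h2, h3⟩
    exact chordal_of_lq G t m h1 h2 h3
end

section
/- Let G be a connected chordal finite simple graph. Then the diameter of the complement graph G^c is at most 3 (where the diameter is infinite if G^c is disconnected; in particular, if G^c is connected its diameter is at most 3, and the statement asserts dist_{G^c}(u,v) ≤ 3 for all vertices u, v whenever finite, i.e. there exist no two vertices at distance 4 in G^c). -/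
/-- Let `G` be a connected chordal finite simple graph.  Then the
diameter of the complement graph `Gᶜ` is at most `3`: any two vertices that are
reachable from one another in `Gᶜ` are at distance at most `3` in `Gᶜ`. -/
theorem chordal_compl_diam_le_three (V : Type) [Fintype V] (G : SimpleGraph V)
    (hconn : G.Connected) (hchordal : G.IsChordal) :
    ∀ u v : V, (Gᶜ).Reachable u v → (Gᶜ).dist u v ≤ 3 := by
  intro u v hr
  by_contra hd
  have key : ∀ w : (Gᶜ).Walk u v, ¬ w.length ≤ 3 := fun w hw =>
    hd ((SimpleGraph.dist_le w).trans hw)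
  have huv : u ≠ v := by
    rintro rfl
    exact key SimpleGraph.Walk.nil (by simp)
  obtain ⟨b, hb⟩ : ∃ b, (Gᶜ).Adj u b := by
    obtain ⟨w⟩ := hr
    cases w with
    | nil => exact absurd rfl huv
    | cons h _ => exact ⟨_, h⟩
  obtain ⟨c, hc⟩ : ∃ c, (Gᶜ).Adj v c := by
    obtain ⟨w⟩ := hr.symm
    cases w with
    | nil => exact absurd rfl huv
    | cons h _ => exact ⟨_, h⟩
  have n1 : ¬ (Gᶜ).Adj u v := fun h => key h.toWalk (by simp)
  have n2 : ¬ (Gᶜ).Adj u c := fun h => key (.cons h (.cons hc.symm .nil)) (by simp)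
  have n3 : ¬ (Gᶜ).Adj b v := fun h => key (.cons hb (.cons h .nil)) (by simp)
  have n4 : ¬ (Gᶜ).Adj b c := fun h => key (.cons hb (.cons h (.cons hc.symm .nil))) (by simp)
  have e2 : u ≠ c := by rintro rfl; exact n1 hc.symm
  have e3 : b ≠ v := by rintro rfl; exact n1 hb
  have e4 : b ≠ c := by rintro rfl; exact n2 hb
  rw [SimpleGraph.compl_adj] at hb hc n1 n2 n3 n4
  have a1 : G.Adj u v := by tauto
  have a2 : G.Adj u c := by tauto
  have a3 : G.Adj b v := by tauto
  have a4 : G.Adj b c := by tauto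
  have e5 := hb.1
  have e6 := hc.1
  have m5 := hb.2
  have m6 := hc.2
  refine (hchordal 4 le_rfl).false ⟨⟨![u, c, b, v], ?_⟩, ?_⟩
  · intro i j
    fin_cases i <;> fin_cases j <;> simp [*, e2.symm, e3.symm, e4.symm, e5.symm, e6.symm, huv.symm]
  · intro i j
    change G.Adj (![u, c, b, v] i) (![u, c, b, v] j) ↔ (SimpleGraph.cycleGraph 4).Adj i j
    have m7 : ¬ G.Adj b u := fun h => m5 h.symm
    have m8 : ¬ G.Adj c v := fun h => m6 h.symm
    fin_cases i <;> fin_cases j <;>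
      first
      | exact iff_of_true a1 (by decide)
      | exact iff_of_true a2 (by decide)
      | exact iff_of_true a3 (by decide)
      | exact iff_of_true a4 (by decide)
      | exact iff_of_true a1.symm (by decide)
      | exact iff_of_true a2.symm (by decide)
      | exact iff_of_true a3.symm (by decide)
      | exact iff_of_true a4.symm (by decide)
      | exact iff_of_false m5 (by decide)
      | exact iff_of_false m6 (by decide)
      | exact iff_of_false m7 (by decide)
      | exact iff_of_false m8 (by decide)
      | exact iff_of_false (G.irrefl) (by decide)
end

section
/- Let I be a squarefree monomial ideal in k[x_1,...,x_n]. Then I has d-quotients if and only if the Alexander dual simplicial complex Delta* of the Stanley–Reisner complex of I — equivalently, the simplicial complex whose facets are the complements [n] \ m_i of the supports m_i of the minimal monomial generators of I — is d-shellable. -/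
open MvPolynomial

/-- A squarefree monomial ideal `I` has *`d`-quotients* if its minimal monomial
generators can be ordered `x^{m 0}, …, x^{m (t-1)}` so that for every `s` the colon
ideal `(x^{m 0}, …, x^{m (s-1)}) : x^{m s}` is generated by monomials of degree `d`. -/
def HasDQuotients (k : Type) {V : Type} [Field k] [Fintype V] [DecidableEq V]
    (d : ℕ) (I : Ideal (MvPolynomial V k)) : Prop :=
  ∃ (t : ℕ) (m : Fin t → Finset V),
    (∀ a b : Fin t, m a ⊆ m b → a = b) ∧
    I = Ideal.span (Set.range fun s => sqMonomial k (m s)) ∧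
    ∀ s : Fin t, ∃ B : Finset (V →₀ ℕ),
      (∀ b ∈ B, (b.sum fun _ e => e) = d) ∧
      Submodule.colon
          (Ideal.span {p | ∃ s' : Fin t, s' < s ∧ p = sqMonomial k (m s')})
          (Ideal.span {sqMonomial k (m s)}) =
        Ideal.span ((fun b => (monomial b (1 : k) : MvPolynomial V k)) '' ↑B)

/-- `F 0, F 1, …, F (t-1)` is a *`d`-shelling order* of the simplicial complex generated
by the facets `F i`: for every `j` with `0 < j`, the intersection of the simplex `⟨F j⟩`
with the complex `⟨F 0, …, F (j-1)⟩` is nonempty and is generated by proper faces of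
`F j` of dimension `|F j| - d - 1` (i.e. every face of the intersection is contained in
a face of the intersection of cardinality `|F j| - d`).  `1`-shellability is ordinary
shellability. -/
def IsDShellingOrder {V : Type} [DecidableEq V] (d : ℕ) {t : ℕ}
    (F : Fin t → Finset V) : Prop :=
  ∀ j : Fin t, 0 < (j : ℕ) →
    (∃ G : Finset V, G ⊆ F j ∧ ∃ i, i < j ∧ G ⊆ F i) ∧
      ∀ G : Finset V, G ⊆ F j → (∃ i, i < j ∧ G ⊆ F i) →
        ∃ G' : Finset V, G' ⊆ F j ∧ (∃ i, i < j ∧ G' ⊆ F i) ∧ G ⊆ G' ∧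
          G'.card + d = (F j).card

/-- Exponent vector of a squarefree monomial. -/
noncomputable def dqInd {V : Type} (F : Finset V) : V →₀ ℕ :=
  ∑ v ∈ F, Finsupp.single v 1

theorem dqInd_apply {V : Type} [DecidableEq V] (F : Finset V) (v : V) :
    dqInd F v = if v ∈ F then 1 else 0 := by
  simp [dqInd, Finsupp.finsetSum_apply, Finsupp.single_apply]

theorem dq_sqMonomial_eq (k : Type) {V : Type} [Field k] [DecidableEq V] (F : Finset V) :
    sqMonomial k F = monomial (dqInd F) (1 : k) := by
  unfold sqMonomial dqInd
  rw [monomial_sum_one]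
  rfl

theorem dqInd_le_iff {V : Type} [DecidableEq V] (F : Finset V) (b : V →₀ ℕ) :
    dqInd F ≤ b ↔ F ⊆ b.support := by
  constructor
  · intro h v hv
    have := h v
    rw [dqInd_apply, if_pos hv] at this
    rw [Finsupp.mem_support_iff]; omega
  · intro h v
    rw [dqInd_apply]
    split_ifs with hv
    · have := h hv
      rw [Finsupp.mem_support_iff] at this; omega
    · omega

theorem dqInd_support {V : Type} [DecidableEq V] (F : Finset V) :
    (dqInd F).support = F := by
  ext v; simp [dqInd_apply]

theorem dqInd_sum {V : Type} [DecidableEq V] (F : Finset V) :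
    ((dqInd F).sum fun _ e => e) = F.card := by
  rw [Finsupp.sum, dqInd_support, Finset.card_eq_sum_ones]
  refine Finset.sum_congr rfl fun v hv => ?_
  rw [dqInd_apply, if_pos hv]

theorem dqInd_le_add_iff {V : Type} [DecidableEq V] (F G : Finset V) (b : V →₀ ℕ) :
    dqInd F ≤ b + dqInd G ↔ F \ G ⊆ b.support := by
  constructor
  · intro h v hv
    rw [Finset.mem_sdiff] at hv
    have := h v
    rw [Finsupp.add_apply, dqInd_apply, dqInd_apply, if_pos hv.1, if_neg hv.2] at this
    rw [Finsupp.mem_support_iff]; omega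
  · intro h v
    rw [Finsupp.add_apply, dqInd_apply, dqInd_apply]
    by_cases hF : v ∈ F
    · by_cases hG : v ∈ G
      · simp [hF, hG]
      · have := h (Finset.mem_sdiff.2 ⟨hF, hG⟩)
        rw [Finsupp.mem_support_iff] at this
        simp [hF, hG]; omega
    · simp [hF]

/-- Membership in the colon ideal. -/
theorem dq_mem_colon (k : Type) {V : Type} [Field k] [DecidableEq V] {t : ℕ}
    (m : Fin t → Finset V) (s : Fin t) (p : MvPolynomial V k) :
    p ∈ Submodule.colon
          (Ideal.span {p | ∃ s' : Fin t, s' < s ∧ p = sqMonomial k (m s')})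
          (Ideal.span {sqMonomial k (m s)}) ↔
      ∀ b ∈ p.support, ∃ i, i < s ∧ m i \ m s ⊆ b.support := by
  have hset : {p | ∃ s' : Fin t, s' < s ∧ p = sqMonomial k (m s')} =
      (fun b => (monomial b (1 : k) : MvPolynomial V k)) '' ((fun i => dqInd (m i)) '' {i | i < s}) := by
    ext q
    simp only [Set.mem_ofPred_eq, Set.mem_image, dq_sqMonomial_eq, exists_exists_and_eq_and]
    exact ⟨fun ⟨i, h, e⟩ => ⟨i, h, e.symm⟩, fun ⟨i, h, e⟩ => ⟨i, h, e.symm⟩⟩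
  have h1 : p ∈ Submodule.colon
          (Ideal.span {p | ∃ s' : Fin t, s' < s ∧ p = sqMonomial k (m s')})
          (Ideal.span {sqMonomial k (m s)}) ↔ p * sqMonomial k (m s) ∈
          Ideal.span {p | ∃ s' : Fin t, s' < s ∧ p = sqMonomial k (m s')} := by
    rw [Submodule.mem_colon]
    constructor
    · intro h
      exact h _ (Ideal.subset_span rfl)
    · intro h q hq
      obtain ⟨c, rfl⟩ := Ideal.mem_span_singleton'.1 hq
      have := Ideal.mul_mem_left _ c h
      rw [smul_eq_mul]
      convert this using 1
      ring
  rw [h1, hset, mem_ideal_span_monomial_image, dq_sqMonomial_eq]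
  constructor
  · intro h b hb
    obtain ⟨_, ⟨i, hi, rfl⟩, hle⟩ := h (b + dqInd (m s)) (by
      rw [mem_support_iff, coeff_mul_monomial, mul_one]; exact mem_support_iff.1 hb)
    exact ⟨i, hi, (dqInd_le_add_iff _ _ _).1 hle⟩
  · intro h x hx
    rw [mem_support_iff, coeff_mul_monomial'] at hx
    split_ifs at hx with hle
    · rw [mul_one] at hx
      obtain ⟨i, hi, hs⟩ := h _ (mem_support_iff.2 hx)
      refine ⟨_, ⟨i, hi, rfl⟩, ?_⟩
      have := (dqInd_le_add_iff _ _ _).2 hs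
      rwa [tsub_add_cancel_of_le hle] at this
    · exact absurd rfl hx

/-- The combinatorial condition equivalent to both sides. -/
def dqCond {V : Type} [DecidableEq V] (d : ℕ) {t : ℕ} (m : Fin t → Finset V) : Prop :=
  ∀ s i : Fin t, i < s → ∃ i', i' < s ∧ ∃ C : Finset V,
    C.card = d ∧ m i' \ m s ⊆ C ∧ C ⊆ m i \ m s

theorem dq_quot_iff (k : Type) {V : Type} [Field k] [Fintype V] [DecidableEq V] (d : ℕ) {t : ℕ}
    (m : Fin t → Finset V) :
    (∀ s : Fin t, ∃ B : Finset (V →₀ ℕ),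
      (∀ b ∈ B, (b.sum fun _ e => e) = d) ∧
      Submodule.colon
          (Ideal.span {p | ∃ s' : Fin t, s' < s ∧ p = sqMonomial k (m s')})
          (Ideal.span {sqMonomial k (m s)}) =
        Ideal.span ((fun b => (monomial b (1 : k) : MvPolynomial V k)) '' ↑B)) ↔
    dqCond d m := by
  have hsupp : ∀ b : V →₀ ℕ, (monomial b (1 : k)).support = {b} := fun b => by
    classical
    rw [support_monomial, if_neg one_ne_zero]
  constructor
  · intro h s i hi
    obtain ⟨B, hB, hcol⟩ := h s
    have hm : monomial (dqInd (m i \ m s)) (1 : k) ∈ Submodule.colon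
          (Ideal.span {p | ∃ s' : Fin t, s' < s ∧ p = sqMonomial k (m s')})
          (Ideal.span {sqMonomial k (m s)}) := by
      rw [dq_mem_colon, hsupp]
      intro b hb
      rw [Finset.mem_singleton] at hb
      subst hb
      exact ⟨i, hi, by rw [dqInd_support]⟩
    rw [hcol, mem_ideal_span_monomial_image, hsupp] at hm
    obtain ⟨b, hbB, hle⟩ := hm _ (Finset.mem_singleton_self _)
    have hbm : monomial b (1 : k) ∈ Submodule.colon
          (Ideal.span {p | ∃ s' : Fin t, s' < s ∧ p = sqMonomial k (m s')})
          (Ideal.span {sqMonomial k (m s)}) := by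
      rw [hcol]
      exact Ideal.subset_span ⟨b, hbB, rfl⟩
    rw [dq_mem_colon, hsupp] at hbm
    obtain ⟨i', hi', hs⟩ := hbm _ (Finset.mem_singleton_self _)
    refine ⟨i', hi', b.support, ?_, hs, ?_⟩
    · rw [← hB b hbB, Finsupp.sum, Finset.card_eq_sum_ones]
      refine Finset.sum_congr rfl fun v hv => ?_
      have h1 := hle v
      rw [Finsupp.mem_support_iff] at hv
      rw [dqInd_apply] at h1
      split_ifs at h1 <;> omega
    · intro v hv
      have h1 := hle v
      rw [Finsupp.mem_support_iff] at hv
      rw [dqInd_apply] at h1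
      by_contra hc
      rw [if_neg hc] at h1
      omega
  · intro h s
    classical
    refine ⟨((Finset.univ : Finset (Finset V)).filter
      (fun C => C.card = d ∧ ∃ i', i' < s ∧ m i' \ m s ⊆ C)).image dqInd, ?_, ?_⟩
    · intro b hb
      simp only [Finset.mem_image, Finset.mem_filter, Finset.mem_univ, true_and] at hb
      obtain ⟨C, ⟨hC, -⟩, rfl⟩ := hb
      rw [dqInd_sum, hC]
    · ext p
      rw [dq_mem_colon, mem_ideal_span_monomial_image]
      refine forall₂_congr fun b _ => ?_
      constructor
      · rintro ⟨i, hi, hs⟩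
        obtain ⟨i', hi', C, hC, h1, h2⟩ := h s i hi
        refine ⟨dqInd C, ?_, (dqInd_le_iff _ _).2 (h2.trans hs)⟩
        simp only [Finset.coe_image, Set.mem_image, Finset.mem_coe, Finset.mem_filter,
          Finset.mem_univ, true_and]
        exact ⟨C, ⟨hC, i', hi', h1⟩, rfl⟩
      · rintro ⟨c, hc, hle⟩
        simp only [Finset.coe_image, Set.mem_image, Finset.mem_coe, Finset.mem_filter,
          Finset.mem_univ, true_and] at hc
        obtain ⟨C, ⟨hC, i', hi', h1⟩, rfl⟩ := hc
        exact ⟨i', hi', h1.trans ((dqInd_le_iff _ _).1 hle)⟩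

theorem dq_shell_iff {V : Type} [Fintype V] [DecidableEq V] (d : ℕ) {t : ℕ}
    (m : Fin t → Finset V) :
    IsDShellingOrder d (fun s => (m s)ᶜ) ↔ dqCond d m := by
  constructor
  · intro h s i hi
    have hpos : 0 < (s : ℕ) := lt_of_le_of_lt (Nat.zero_le _) hi
    obtain ⟨G', h1, ⟨i', hi', h2⟩, h3, h4⟩ := (h s hpos).2 ((m s)ᶜ ∩ (m i)ᶜ)
      Finset.inter_subset_left ⟨i, hi, Finset.inter_subset_right⟩
    refine ⟨i', hi', (m s)ᶜ \ G', ?_, ?_, ?_⟩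
    · rw [Finset.card_sdiff_of_subset h1]
      dsimp only at h4 ⊢
      omega
    · intro v hv
      have := @h2 v
      simp only [Finset.mem_sdiff, Finset.mem_compl] at *
      tauto
    · intro v hv
      have := @h3 v
      simp only [Finset.mem_sdiff, Finset.mem_compl, Finset.mem_inter] at *
      tauto
  · intro h s hs
    refine ⟨⟨∅, Finset.empty_subset _, ⟨0, by omega⟩, hs, Finset.empty_subset _⟩, ?_⟩
    rintro G hG ⟨i, hi, hGi⟩
    obtain ⟨i', hi', C, hC, h1, h2⟩ := h s i hi
    have hCs : C ⊆ (m s)ᶜ := by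
      intro v hv
      have := h2 hv
      simp only [Finset.mem_sdiff, Finset.mem_compl] at *
      tauto
    refine ⟨(m s)ᶜ \ C, Finset.sdiff_subset, ⟨i', hi', ?_⟩, ?_, ?_⟩
    · intro v hv
      have := @h1 v
      simp only [Finset.mem_sdiff, Finset.mem_compl] at *
      tauto
    · intro v hv
      have a := hG hv
      have b := hGi hv
      have := @h2 v
      simp only [Finset.mem_sdiff, Finset.mem_compl] at *
      tauto
    · rw [← hC]
      exact Finset.card_sdiff_add_card_eq_card hCs

theorem dq_le_of_span (k : Type) {V : Type} [Field k] [DecidableEq V] {t t' : ℕ}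
    (m : Fin t → Finset V) (m' : Fin t' → Finset V)
    (h : Ideal.span (Set.range fun s => sqMonomial k (m s)) =
      Ideal.span (Set.range fun s => sqMonomial k (m' s))) (a : Fin t') :
    ∃ b, m b ⊆ m' a := by
  have h1 : sqMonomial k (m' a) ∈ Ideal.span (Set.range fun s => sqMonomial k (m s)) := by
    rw [h]; exact Ideal.subset_span ⟨a, rfl⟩
  have hset : (Set.range fun s => sqMonomial k (m s)) =
      (fun b => (monomial b (1 : k) : MvPolynomial V k)) '' (Set.range fun s => dqInd (m s)) := by
    rw [← Set.range_comp]
    congr 1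
    ext1 s
    exact dq_sqMonomial_eq k (m s)
  rw [hset, mem_ideal_span_monomial_image, dq_sqMonomial_eq] at h1
  obtain ⟨_, ⟨b, rfl⟩, hle⟩ := h1 (dqInd (m' a)) (by
    rw [mem_support_iff, coeff_monomial, if_pos rfl]; exact one_ne_zero)
  refine ⟨b, ?_⟩
  have := (dqInd_le_iff _ _).1 hle
  rwa [dqInd_support] at this

/-- Uniqueness of the minimal generators. -/
theorem dq_unique (k : Type) {V : Type} [Field k] [DecidableEq V] {t t' : ℕ}
    (m : Fin t → Finset V) (m' : Fin t' → Finset V)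
    (hm : ∀ a b, m a ⊆ m b → a = b) (hm' : ∀ a b, m' a ⊆ m' b → a = b)
    (h : Ideal.span (Set.range fun s => sqMonomial k (m s)) =
      Ideal.span (Set.range fun s => sqMonomial k (m' s))) :
    ∃ e : Fin t' ≃ Fin t, ∀ a, m' a = m (e a) := by
  choose f hf using dq_le_of_span k m m' h
  choose g hg using dq_le_of_span k m' m h.symm
  refine ⟨⟨f, g, fun a => hm' _ _ ((hg _).trans (hf a)),
    fun a => hm _ _ ((hf _).trans (hg a))⟩, fun a => ?_⟩
  refine Finset.Subset.antisymm ?_ (hf a)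
  have : g (f a) = a := hm' _ _ ((hg _).trans (hf a))
  have h2 := hg (f a)
  rwa [this] at h2

/-- Let `I` be a squarefree monomial ideal of `k[x_v : v ∈ V]`, with
minimal monomial generators `x^{m s}` (`s : Fin t`; the `m s` are pairwise incomparable
under inclusion).  Then `I` has `d`-quotients if and only if the Alexander dual
simplicial complex of the Stanley–Reisner complex of `I` — the simplicial complex whose
facets are the complements `(m s)ᶜ` of the supports of the minimal generators of `I` —
is `d`-shellable, i.e. admits an ordering of its facets which is a `d`-shelling. -/
theorem hasDQuotients_iff_dual_dShellable (k V : Type) [Field k] [Fintype V]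
    [DecidableEq V] (d t : ℕ) (m : Fin t → Finset V)
    (hmin : ∀ a b : Fin t, m a ⊆ m b → a = b)
    (I : Ideal (MvPolynomial V k))
    (hI : I = Ideal.span (Set.range fun s => sqMonomial k (m s))) :
    HasDQuotients k d I ↔
      ∃ σ : Equiv.Perm (Fin t), IsDShellingOrder d (fun s => (m (σ s))ᶜ) := by
  constructor
  · rintro ⟨t', m', hmin', hI', hq⟩
    obtain ⟨e, he⟩ := dq_unique k m m' hmin hmin' (hI.symm.trans hI')
    have htt : t' = t := by simpa using Fintype.card_congr e
    subst htt
    refine ⟨e, ?_⟩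
    rw [dq_shell_iff d (fun s => m (e s))]
    have : m' = fun s => m (e s) := funext he
    rw [← this]
    exact (dq_quot_iff k d m').1 hq
  · rintro ⟨σ, hσ⟩
    rw [dq_shell_iff d (fun s => m (σ s))] at hσ
    refine ⟨t, fun s => m (σ s), fun a b hab => σ.injective (hmin _ _ hab), ?_,
      (dq_quot_iff k d _).2 hσ⟩
    rw [hI]
    congr 1
    exact (σ.surjective.range_comp (fun s => sqMonomial k (m s))).symm
end

section
/- Let Delta be a d-shellable simplicial complex and F a face of Delta. Then the link lk_Delta(F) is again d-shellable. -/
/-- Let `Δ` be a `d`-shellable simplicial complex, given by its facets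
`F 0, …, F (t-1)` (pairwise incomparable), and let `F₀` be a face of `Δ`.  Then the link
`lk_Δ(F₀)` — the simplicial complex whose facets are the sets `F i \ F₀` over the facets
`F i` containing `F₀` — is again `d`-shellable. -/
theorem link_dShellable (V : Type) [DecidableEq V] (d t : ℕ) (F : Fin t → Finset V)
    (hfacets : ∀ a b : Fin t, F a ⊆ F b → a = b)
    (hshell : ∃ σ : Equiv.Perm (Fin t), IsDShellingOrder d (F ∘ σ))
    (F₀ : Finset V) (hface : ∃ i, F₀ ⊆ F i) :
    ∃ (r : ℕ) (G : Fin r → Finset V),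
      Function.Injective G ∧
      Set.range G = {A : Finset V | ∃ i, F₀ ⊆ F i ∧ A = F i \ F₀} ∧
      IsDShellingOrder d G := by
  obtain ⟨σ, hσ⟩ := hshell
  let S : Finset (Fin t) := Finset.univ.filter (fun i => F₀ ⊆ F (σ i))
  let e : Fin S.card ≃o S := S.orderIsoOfFin rfl
  have he : ∀ k, F₀ ⊆ F (σ (e k : Fin t)) := fun k =>
    (Finset.mem_filter.1 (e k).2).2
  have hlt : ∀ a b, (e a : Fin t) < (e b : Fin t) ↔ a < b := fun a b => by
    rw [Subtype.coe_lt_coe, e.lt_iff_lt]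
  have hsurj : ∀ i, F₀ ⊆ F (σ i) → ∃ k, (e k : Fin t) = i := fun i hi =>
    ⟨e.symm ⟨i, by simpa [S] using hi⟩, by simp⟩
  refine ⟨S.card, fun k => F (σ (e k)) \ F₀, ?_, ?_, ?_⟩
  · intro a b hab
    have hab' : F (σ (e a)) \ F₀ = F (σ (e b)) \ F₀ := hab
    have h1 : F (σ (e a)) = F (σ (e b)) := by
      rw [← Finset.sdiff_union_of_subset (he a), hab', Finset.sdiff_union_of_subset (he b)]
    have h2 := hfacets _ _ h1.subset
    exact e.injective (Subtype.ext (σ.injective h2))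
  · ext A
    constructor
    · rintro ⟨k, rfl⟩
      exact ⟨_, he k, rfl⟩
    · rintro ⟨i, hi, rfl⟩
      obtain ⟨k, hk⟩ := hsurj (σ.symm i) (by simpa using hi)
      exact ⟨k, by simp [hk]⟩
  · intro j hj
    have hpos : ∃ i, i < j := ⟨⟨0, by omega⟩, hj⟩
    refine ⟨⟨∅, by simp, hpos.imp fun i hi => ⟨hi, by simp⟩⟩, ?_⟩
    rintro G hG ⟨i, hij, hGi⟩
    have hij' := (hlt i j).2 hij
    have key := (hσ (e j) (lt_of_le_of_lt (Nat.zero_le _) hij')).2 (G ∪ F₀)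
      (Finset.union_subset (hG.trans Finset.sdiff_subset) (he j))
      ⟨e i, hij', Finset.union_subset (hGi.trans Finset.sdiff_subset) (he i)⟩
    obtain ⟨G', hG'j, ⟨i', hi', hG'i⟩, hGG', hcard⟩ := key
    have hF₀ : F₀ ⊆ G' := Finset.subset_union_right.trans hGG'
    obtain ⟨k, rfl⟩ := hsurj i' (hF₀.trans hG'i)
    refine ⟨G' \ F₀, Finset.sdiff_subset_sdiff hG'j subset_rfl,
      ⟨k, (hlt k j).1 hi', Finset.sdiff_subset_sdiff hG'i subset_rfl⟩, ?_, ?_⟩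
    · intro x hx
      exact Finset.mem_sdiff.2 ⟨hGG' (Finset.mem_union_left _ hx), (Finset.mem_sdiff.1 (hG hx)).2⟩
    · have h1 := Finset.card_sdiff_add_card_eq_card hF₀
      have h2 := Finset.card_sdiff_add_card_eq_card (he j)
      simp only [Function.comp_apply] at hcard
      show (G' \ F₀).card + d = (F (σ (e j)) \ F₀).card
      omega
end

section
/- Let I = (x^{m_1},...,x^{m_t}) be a squarefree monomial ideal in R = k[x_1,...,x_n] with all minimal generators of degree d', having d-quotients (d ≤ d') with respect to the ordering x^{m_1},...,x^{m_t}, and assume moreover that for every s = 2,...,t the minimal monomial generators of I_{s-1} : x^{m_s} form a regular sequence of length r_s (where I_{s-1} = (x^{m_1},...,x^{m_{s-1}})). Then beta_{i,j}(R/I) is nonzero only for j = i + d' - 1 + (i-1)(d-1), and for all 2 ≤ i ≤ pd_R(R/I), beta_i(R/I) = sum over s = 2,...,t of C(r_s, i-1). -/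
open MvPolynomial

/-- A *minimal graded free resolution* of `R ⧸ I`, where `R = k[x_v : v ∈ V]` is the
polynomial ring with its standard grading.  The `i`-th free module is
`⨁_j R(-j)^{β i j}`, encoded as finitely supported functions on `Σ j, Fin (β i j)`
(the basis element `⟨j, t⟩` having degree `j`).  The graded Betti number
`β_{i,j}(R ⧸ I) = dim_k Tor_i^R(R ⧸ I, k)_j` equals `β i j` for any such resolution. -/
structure MinimalGradedFreeResolution (k V : Type) [Field k] [Fintype V] [DecidableEq V]
    (I : Ideal (MvPolynomial V k)) where
  /-- the ranks: `β i j` copies of `R(-j)` in homological degree `i` -/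
  β : ℕ → ℕ → ℕ
  /-- the `0`-th free module is a single copy of `R` generated in degree `0` -/
  β_zero : ∀ j, β 0 j = if j = 0 then 1 else 0
  /-- the differentials -/
  d : ∀ i : ℕ,
    ((Σ j : ℕ, Fin (β (i + 1) j)) →₀ MvPolynomial V k) →ₗ[MvPolynomial V k]
      ((Σ j : ℕ, Fin (β i j)) →₀ MvPolynomial V k)
  /-- the augmentation onto `R ⧸ I` -/
  aug : ((Σ j : ℕ, Fin (β 0 j)) →₀ MvPolynomial V k) →ₗ[MvPolynomial V k]
      (MvPolynomial V k ⧸ I)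
  aug_surjective : Function.Surjective aug
  /-- exactness at homological degree `0` -/
  exact_zero : LinearMap.ker aug = LinearMap.range (d 0)
  /-- exactness at homological degree `i + 1` -/
  exact_succ : ∀ i, LinearMap.ker (d i) = LinearMap.range (d (i + 1))
  /-- minimality: the image of each differential lies in `m · F`, where `m = (x_v : v ∈ V)` -/
  minimal : ∀ i x p, constantCoeff ((d i x) p) = 0
  /-- the differentials are graded: the image of a degree-`j` basis vector is homogeneous
  of degree `j` -/
  graded : ∀ (i j : ℕ) (t : Fin (β (i + 1) j)) (p : Σ j' : ℕ, Fin (β i j')),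
      ((d i (Finsupp.single ⟨j, t⟩ 1)) p).IsHomogeneous (j - p.1) ∧
        (p.1 ≤ j ∨ (d i (Finsupp.single ⟨j, t⟩ 1)) p = 0)

/-- The edge ideal `I(H)` of a hypergraph with edges `E 0, …, E (n-1)`:
the ideal generated by the squarefree monomials `x^{E i} = ∏_{v ∈ E i} x_v`. -/
noncomputable def edgeIdeal (k : Type) {V : Type} [Field k] [Fintype V] [DecidableEq V]
    {n : ℕ} (E : Fin n → Finset V) : Ideal (MvPolynomial V k) :=
  Ideal.span (Set.range fun i => ∏ v ∈ E i, (X v : MvPolynomial V k))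

section Aux

variable {k V : Type} [Field k]

/-- `x` is homogeneous of degree `n` in the graded free module with basis degrees `deg`. -/
def HomEl {ι : Type} (deg : ι → ℕ) (n : ℕ) (x : ι →₀ MvPolynomial V k) : Prop :=
  ∀ q m, coeff m (x q) ≠ 0 → m.degree + deg q = n

theorem HomEl.zero {ι : Type} (deg : ι → ℕ) (n : ℕ) :
    HomEl deg n (0 : ι →₀ MvPolynomial V k) := by
  intro q m h; simp at h

theorem HomEl.add {ι : Type} {deg : ι → ℕ} {n : ℕ} {x y : ι →₀ MvPolynomial V k}
    (hx : HomEl deg n x) (hy : HomEl deg n y) : HomEl deg n (x + y) := by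
  intro q m h
  by_cases h1 : coeff m (x q) = 0
  · apply hy q m
    intro h2
    apply h
    simp [h1, h2]
  · exact hx q m h1

theorem HomEl.neg {ι : Type} {deg : ι → ℕ} {n : ℕ} {x : ι →₀ MvPolynomial V k}
    (hx : HomEl deg n x) : HomEl deg n (-x) := by
  intro q m h
  apply hx q m
  simpa using h

theorem HomEl.smul {ι : Type} {deg : ι → ℕ} {n a e : ℕ} {f : MvPolynomial V k}
    {y : ι →₀ MvPolynomial V k}
    (hf : ∀ m, coeff m f ≠ 0 → m.degree + a = n)
    (hy : HomEl deg (a + e) y) : HomEl deg (n + e) (f • y) := by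
  classical
  intro q m h
  rw [Finsupp.smul_apply, smul_eq_mul, coeff_mul] at h
  obtain ⟨⟨u, v⟩, huv, hne⟩ := Finset.exists_ne_zero_of_sum_ne_zero h
  have h1 := hf u (left_ne_zero_of_mul hne)
  have h2 := hy q v (right_ne_zero_of_mul hne)
  rw [Finset.HasAntidiagonal.mem_antidiagonal] at huv
  subst huv
  simp only at h1 h2 ⊢
  rw [map_add]
  omega

/-- graded map of degree `e` -/
def IsGr {A B : Type} (degA : A → ℕ) (degB : B → ℕ) (e : ℕ)
    (α : (A →₀ MvPolynomial V k) →ₗ[MvPolynomial V k] (B →₀ MvPolynomial V k)) : Prop :=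
  ∀ p, HomEl degB (degA p + e) (α (Finsupp.single p 1))

theorem map_single_eq {A : Type} {N : Type} [AddCommGroup N] [Module (MvPolynomial V k) N]
    (α : (A →₀ MvPolynomial V k) →ₗ[MvPolynomial V k] N)
    (p : A) (f : MvPolynomial V k) :
    α (Finsupp.single p f) = f • α (Finsupp.single p 1) := by
  rw [← map_smul, Finsupp.smul_single, smul_eq_mul, mul_one]

theorem IsGr.map {A B : Type} {degA : A → ℕ} {degB : B → ℕ} {e : ℕ}
    {α : (A →₀ MvPolynomial V k) →ₗ[MvPolynomial V k] (B →₀ MvPolynomial V k)}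
    (hα : IsGr degA degB e α) {n : ℕ} {x : A →₀ MvPolynomial V k} (hx : HomEl degA n x) :
    HomEl degB (n + e) (α x) := by
  classical
  have h : ∀ s : Finset A, HomEl degB (n + e) (α (∑ p ∈ s, Finsupp.single p (x p))) := by
    intro s
    induction s using Finset.induction_on with
    | empty => simpa using HomEl.zero _ _
    | insert p s hp ih =>
      rw [Finset.sum_insert hp, map_add, map_single_eq]
      exact HomEl.add (HomEl.smul (hx p) (hα p)) ih
  have := h x.support
  rwa [show ∑ p ∈ x.support, Finsupp.single p (x p) = x from Finsupp.sum_single x] at this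

/-- projection of a polynomial to degree `n - a` -/
noncomputable def prj (n a : ℕ) : MvPolynomial V k →ₗ[k] MvPolynomial V k :=
  if a ≤ n then homogeneousComponent (n - a) else 0

theorem coeff_prj (n a : ℕ) (f : MvPolynomial V k) (m : V →₀ ℕ) :
    coeff m (prj n a f) = if m.degree + a = n then coeff m f else 0 := by
  unfold prj
  split_ifs with h1 h2 h2
  · rw [coeff_homogeneousComponent, if_pos (by omega)]
  · rw [coeff_homogeneousComponent, if_neg (by omega)]
  · omega
  · simp

/-- the degree `n` component -/
noncomputable def hcmp {ι : Type} (deg : ι → ℕ) (n : ℕ) :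
    (ι →₀ MvPolynomial V k) →ₗ[k] (ι →₀ MvPolynomial V k) :=
  Finsupp.lsum k (fun p => (Finsupp.lsingle p) ∘ₗ (prj n (deg p)))

theorem hcmp_apply {ι : Type} (deg : ι → ℕ) (n : ℕ) (x : ι →₀ MvPolynomial V k) (q : ι) :
    hcmp deg n x q = prj n (deg q) (x q) := by
  classical
  induction x using Finsupp.induction_linear with
  | zero => simp
  | add x y hx hy => simp [hx, hy]
  | single p f =>
    simp only [hcmp, Finsupp.lsum_single, LinearMap.comp_apply, Finsupp.lsingle_apply]
    by_cases h : p = q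
    · subst h; simp
    · simp [Finsupp.single_apply, h]

theorem homEl_hcmp {ι : Type} (deg : ι → ℕ) (n : ℕ) (x : ι →₀ MvPolynomial V k) :
    HomEl deg n (hcmp deg n x) := by
  intro q m h
  rw [hcmp_apply, coeff_prj] at h
  by_contra hc
  exact h (if_neg hc)

theorem hcmp_homEl {ι : Type} {deg : ι → ℕ} {n n' : ℕ} {x : ι →₀ MvPolynomial V k}
    (hx : HomEl deg n' x) : hcmp deg n x = if n' = n then x else 0 := by
  ext q m
  rw [hcmp_apply, coeff_prj]
  have := hx q m
  by_cases h : coeff m (x q) = 0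
  · split_ifs <;> simp [h]
  · have := this h
    rw [this]
    split_ifs <;> simp

theorem map_cmp {A B : Type} {degA : A → ℕ} {degB : B → ℕ}
    {α : (A →₀ MvPolynomial V k) →ₗ[MvPolynomial V k] (B →₀ MvPolynomial V k)}
    (hα : IsGr degA degB 0 α) (n : ℕ) (x : A →₀ MvPolynomial V k) :
    α (hcmp degA n x) = hcmp degB n (α x) := by
  classical
  induction x using Finsupp.induction_linear with
  | zero => simp
  | add x y hx hy => simp [hx, hy]
  | single p f =>
    induction f using MvPolynomial.induction_on' with
    | add f g hf hg => simp only [Finsupp.single_add, map_add, hf, hg]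
    | monomial m a =>
      have h1 : HomEl degA (m.degree + degA p) (Finsupp.single p (monomial m a)) := by
        intro q m' h
        by_cases hpq : p = q
        · subst hpq
          rw [Finsupp.single_eq_same, coeff_monomial] at h
          have : m = m' := by
            by_contra hc; exact h (if_neg hc)
          rw [this]
        · simp [Finsupp.single_apply, hpq] at h
      have h2 := hα.map h1
      rw [hcmp_homEl h1, hcmp_homEl h2, add_zero]
      split_ifs <;> simp

theorem exists_hom_lift {A B : Type} {degA : A → ℕ} {degB : B → ℕ}
    {α : (A →₀ MvPolynomial V k) →ₗ[MvPolynomial V k] (B →₀ MvPolynomial V k)}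
    (hα : IsGr degA degB 0 α) {n : ℕ} {y : B →₀ MvPolynomial V k} (hy : HomEl degB n y)
    (hr : y ∈ LinearMap.range α) : ∃ x, HomEl degA n x ∧ α x = y := by
  obtain ⟨x, rfl⟩ := hr
  exact ⟨hcmp degA n x, homEl_hcmp _ _ _, by rw [map_cmp hα, hcmp_homEl hy, if_pos rfl]⟩

theorem exists_gr_lift {A B C : Type} {degA : A → ℕ} {degB : B → ℕ} {degC : C → ℕ} {e : ℕ}
    {d : (C →₀ MvPolynomial V k) →ₗ[MvPolynomial V k] (B →₀ MvPolynomial V k)}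
    (hd : IsGr degC degB 0 d)
    {β : (A →₀ MvPolynomial V k) →ₗ[MvPolynomial V k] (B →₀ MvPolynomial V k)}
    (hβ : IsGr degA degB e β) (hr : ∀ x, β x ∈ LinearMap.range d) :
    ∃ γ : (A →₀ MvPolynomial V k) →ₗ[MvPolynomial V k] (C →₀ MvPolynomial V k),
      IsGr degA degC e γ ∧ ∀ x, d (γ x) = β x := by
  have h := fun p => exists_hom_lift hd (hβ p) (hr (Finsupp.single p 1))
  choose g hg1 hg2 using h
  refine ⟨Finsupp.linearCombination _ g, ?_, ?_⟩
  · intro p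
    simpa [Finsupp.linearCombination_single] using hg1 p
  · intro x
    have : d ∘ₗ Finsupp.linearCombination _ g = β := by
      apply Finsupp.lhom_ext
      intro p f
      rw [map_single_eq, map_single_eq β]
      simp [Finsupp.linearCombination_single, hg2]
    exact LinearMap.congr_fun this x

theorem exists_lift {A B C : Type}
    {d : (C →₀ MvPolynomial V k) →ₗ[MvPolynomial V k] (B →₀ MvPolynomial V k)}
    {β : (A →₀ MvPolynomial V k) →ₗ[MvPolynomial V k] (B →₀ MvPolynomial V k)}
    (hr : ∀ x, β x ∈ LinearMap.range d) :
    ∃ γ : (A →₀ MvPolynomial V k) →ₗ[MvPolynomial V k] (C →₀ MvPolynomial V k),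
      ∀ x, d (γ x) = β x := by
  choose g hg2 using fun p => hr (Finsupp.single p 1)
  refine ⟨Finsupp.linearCombination _ g, ?_⟩
  intro x
  have : d ∘ₗ Finsupp.linearCombination _ g = β := by
    apply Finsupp.lhom_ext
    intro p f
    rw [map_single_eq, map_single_eq β]
    simp [Finsupp.linearCombination_single, hg2]
  exact LinearMap.congr_fun this x

/-- a graded free resolution of `R ⧸ I` with `F_0 = R` -/
structure GR (I : Ideal (MvPolynomial V k)) where
  ι : ℕ → Type
  deg : ∀ i, ι i → ℕ
  z : ι 0
  hz : ∀ p, p = z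
  deg_z : deg 0 z = 0
  d : ∀ i, (ι (i + 1) →₀ MvPolynomial V k) →ₗ[MvPolynomial V k] (ι i →₀ MvPolynomial V k)
  gr : ∀ i, IsGr (deg (i + 1)) (deg i) 0 (d i)
  ex0 : ∀ x, x ∈ LinearMap.range (d 0) ↔ x z ∈ I
  ex : ∀ i x, d i x = 0 ↔ x ∈ LinearMap.range (d (i + 1))

theorem GR.dd {I : Ideal (MvPolynomial V k)} (G : GR I) (i : ℕ) (x) :
    G.d i (G.d (i + 1) x) = 0 := (G.ex i _).2 ⟨x, rfl⟩

theorem GR.eq_single {I : Ideal (MvPolynomial V k)} (G : GR I)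
    (x : G.ι 0 →₀ MvPolynomial V k) : x = Finsupp.single G.z (x G.z) := by
  ext p : 1
  rw [G.hz p]; simp

/-- the map in degree zero which is multiplication by `f` -/
noncomputable def GR.mul0 {I J : Ideal (MvPolynomial V k)} (K : GR J) (G : GR I)
    (f : MvPolynomial V k) :
    (K.ι 0 →₀ MvPolynomial V k) →ₗ[MvPolynomial V k] (G.ι 0 →₀ MvPolynomial V k) :=
  Finsupp.linearCombination _ (fun _ => Finsupp.single G.z f)

theorem GR.mul0_apply {I J : Ideal (MvPolynomial V k)} (K : GR J) (G : GR I)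
    (f : MvPolynomial V k) (x) : K.mul0 G f x = Finsupp.single G.z (x K.z * f) := by
  conv_lhs => rw [K.eq_single x]
  simp [GR.mul0, Finsupp.linearCombination_single]

/-- lifting of multiplication by `f` to a chain map -/
theorem GR.exists_chain {I J : Ideal (MvPolynomial V k)} (K : GR J) (G : GR I)
    {f : MvPolynomial V k} {e : ℕ} (hf : f.IsHomogeneous e) (hJ : ∀ y ∈ J, y * f ∈ I) :
    ∃ α : ∀ i, (K.ι i →₀ MvPolynomial V k) →ₗ[MvPolynomial V k] (G.ι i →₀ MvPolynomial V k),
      α 0 = K.mul0 G f ∧ (∀ i, IsGr (K.deg i) (G.deg i) e (α i)) ∧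
      ∀ i x, G.d i (α (i + 1) x) = α i (K.d i x) := by
  let A : ℕ → Type := fun i => {a : (K.ι i →₀ MvPolynomial V k) →ₗ[MvPolynomial V k]
    (G.ι i →₀ MvPolynomial V k) // IsGr (K.deg i) (G.deg i) e a ∧
      ∀ x, a (K.d i x) ∈ LinearMap.range (G.d i)}
  have step : ∀ i (a : A i), ∃ b : A (i + 1), ∀ x, G.d i (b.1 x) = a.1 (K.d i x) := by
    intro i a
    have hgr : IsGr (K.deg (i + 1)) (G.deg i) e (a.1 ∘ₗ K.d i) := by
      intro p
      exact a.2.1.map (K.gr i p)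
    obtain ⟨γ, h1, h2⟩ := exists_gr_lift (G.gr i) hgr a.2.2
    refine ⟨⟨γ, h1, ?_⟩, h2⟩
    intro x
    rw [← G.ex, h2]
    simp [K.dd]
  choose st hst using step
  have h0 : IsGr (K.deg 0) (G.deg 0) e (K.mul0 G f) := by
    intro p
    rw [K.hz p, K.deg_z, GR.mul0_apply]
    intro q m h
    rw [G.hz q] at h ⊢
    rw [G.deg_z]
    simp only [Finsupp.single_eq_same, one_mul] at h
    by_contra hc
    exact h (hf.coeff_eq_zero (by omega))
  let a0 : A 0 := ⟨K.mul0 G f, h0, by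
    intro x
    rw [G.ex0, GR.mul0_apply, Finsupp.single_eq_same]
    exact hJ _ ((K.ex0 _).1 ⟨x, rfl⟩)⟩
  let s : ∀ i, A i := fun i => Nat.rec a0 st i
  exact ⟨fun i => (s i).1, rfl, fun i => (s i).2.1, fun i => hst i (s i)⟩

end Aux
section Cone

variable {k V : Type} [Field k]

/-- index types of the mapping cone -/
def coneι (A B : ℕ → Type) : ℕ → Type
  | 0 => A 0
  | (i + 1) => A (i + 1) ⊕ B i

/-- degrees of the mapping cone -/
def coneDeg {A B : ℕ → Type} (a : ∀ i, A i → ℕ) (b : ∀ i, B i → ℕ) (e : ℕ) :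
    ∀ i, coneι A B i → ℕ
  | 0 => a 0
  | (i + 1) => Sum.elim (a (i + 1)) (fun p => b i p + e)

/-- the left part of an element of the free module on a sum -/
noncomputable def pL {A B : Type} {R : Type} [CommRing R] : (A ⊕ B →₀ R) →ₗ[R] (A →₀ R) :=
  LinearMap.fst R _ _ ∘ₗ (Finsupp.sumFinsuppLEquivProdFinsupp R).toLinearMap

/-- the right part of an element of the free module on a sum -/
noncomputable def pR {A B : Type} {R : Type} [CommRing R] : (A ⊕ B →₀ R) →ₗ[R] (B →₀ R) :=
  LinearMap.snd R _ _ ∘ₗ (Finsupp.sumFinsuppLEquivProdFinsupp R).toLinearMap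

/-- assemble an element of the free module on a sum -/
noncomputable def mkS {A B : Type} {R : Type} [CommRing R] :
    ((A →₀ R) × (B →₀ R)) →ₗ[R] (A ⊕ B →₀ R) :=
  (Finsupp.sumFinsuppLEquivProdFinsupp R).symm.toLinearMap

section parts
variable {A B : Type} {R : Type} [CommRing R]

@[simp] theorem pL_mkS (x : A →₀ R) (y : B →₀ R) : pL (mkS (x, y)) = x := by
  simp [pL, mkS]

@[simp] theorem pR_mkS (x : A →₀ R) (y : B →₀ R) : pR (mkS (x, y)) = y := by
  simp [pR, mkS]

theorem mkS_parts (w : A ⊕ B →₀ R) : mkS (pL w, pR w) = w := by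
  simp [pL, pR, mkS]

theorem mkS_inl (x : A →₀ R) (y : B →₀ R) (p : A) : mkS (x, y) (Sum.inl p) = x p := by
  simp [mkS]

theorem mkS_inr (x : A →₀ R) (y : B →₀ R) (p : B) : mkS (x, y) (Sum.inr p) = y p := by
  simp [mkS]

theorem mkS_zero_iff (x : A →₀ R) (y : B →₀ R) : mkS (x, y) = 0 ↔ x = 0 ∧ y = 0 := by
  constructor
  · intro h
    exact ⟨by rw [← pL_mkS x y, h, map_zero], by rw [← pR_mkS x y, h, map_zero]⟩
  · rintro ⟨rfl, rfl⟩
    exact map_zero _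

theorem pL_inl (p : A) : pL (Finsupp.single (Sum.inl p : A ⊕ B) (1 : R)) = Finsupp.single p 1 := by
  classical
  ext q; simp [pL, Finsupp.single_apply]

theorem pR_inl (p : A) : pR (Finsupp.single (Sum.inl p : A ⊕ B) (1 : R)) = 0 := by
  classical
  ext q; simp [pR, Finsupp.single_apply]

theorem pL_inr (p : B) : pL (Finsupp.single (Sum.inr p : A ⊕ B) (1 : R)) = 0 := by
  classical
  ext q; simp [pL, Finsupp.single_apply]

theorem pR_inr (p : B) : pR (Finsupp.single (Sum.inr p : A ⊕ B) (1 : R)) = Finsupp.single p 1 := by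
  classical
  ext q; simp [pR, Finsupp.single_apply]
end parts

/-- lowest differential of the mapping cone -/
noncomputable def coneD0 {R : Type} [CommRing R] {A1 A0 B0 : Type}
    (dA : (A1 →₀ R) →ₗ[R] (A0 →₀ R)) (α : (B0 →₀ R) →ₗ[R] (A0 →₀ R)) :
    (A1 ⊕ B0 →₀ R) →ₗ[R] (A0 →₀ R) := dA ∘ₗ pL + α ∘ₗ pR

theorem coneD0_mkS {R : Type} [CommRing R] {A1 A0 B0 : Type}
    (dA : (A1 →₀ R) →ₗ[R] (A0 →₀ R)) (α : (B0 →₀ R) →ₗ[R] (A0 →₀ R)) (x y) :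
    coneD0 dA α (mkS (x, y)) = dA x + α y := by
  simp [coneD0]

/-- higher differentials of the mapping cone -/
noncomputable def coneDS {R : Type} [CommRing R] {A1 A0 B1 B0 : Type}
    (dA : (A1 →₀ R) →ₗ[R] (A0 →₀ R)) (dB : (B1 →₀ R) →ₗ[R] (B0 →₀ R))
    (α : (B1 →₀ R) →ₗ[R] (A0 →₀ R)) :
    (A1 ⊕ B1 →₀ R) →ₗ[R] (A0 ⊕ B0 →₀ R) :=
  mkS ∘ₗ LinearMap.prod (dA ∘ₗ pL + α ∘ₗ pR) (-(dB ∘ₗ pR))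

theorem coneDS_mkS {R : Type} [CommRing R] {A1 A0 B1 B0 : Type}
    (dA : (A1 →₀ R) →ₗ[R] (A0 →₀ R)) (dB : (B1 →₀ R) →ₗ[R] (B0 →₀ R))
    (α : (B1 →₀ R) →ₗ[R] (A0 →₀ R)) (x y) :
    coneDS dA dB α (mkS (x, y)) = mkS (dA x + α y, - dB y) := by
  simp [coneDS]

/-- differentials of the mapping cone -/
noncomputable def coneD {R : Type} [CommRing R] {A B : ℕ → Type}
    (dA : ∀ i, (A (i + 1) →₀ R) →ₗ[R] (A i →₀ R))
    (dB : ∀ i, (B (i + 1) →₀ R) →ₗ[R] (B i →₀ R))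
    (α : ∀ i, (B i →₀ R) →ₗ[R] (A i →₀ R)) :
    ∀ i, (coneι A B (i + 1) →₀ R) →ₗ[R] (coneι A B i →₀ R)
  | 0 => coneD0 (dA 0) (α 0)
  | (i + 1) => coneDS (dA (i + 1)) (dB i) (α (i + 1))

theorem single_inl_eq {R : Type} [CommRing R] {A B : Type} (p : A) :
    Finsupp.single (Sum.inl p : A ⊕ B) (1 : R) = mkS (Finsupp.single p 1, 0) := by
  rw [← mkS_parts (Finsupp.single (Sum.inl p : A ⊕ B) (1 : R)), pL_inl, pR_inl]

theorem single_inr_eq {R : Type} [CommRing R] {A B : Type} (p : B) :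
    Finsupp.single (Sum.inr p : A ⊕ B) (1 : R) = mkS (0, Finsupp.single p 1) := by
  rw [← mkS_parts (Finsupp.single (Sum.inr p : A ⊕ B) (1 : R)), pL_inr, pR_inr]

theorem homEl_mkS {A B : Type} {dA : A → ℕ} {dB : B → ℕ} {e n : ℕ}
    {x : A →₀ MvPolynomial V k} {y : B →₀ MvPolynomial V k}
    (hx : HomEl dA n x) (hy : HomEl (fun p => dB p + e) n y) :
    HomEl (Sum.elim dA (fun p => dB p + e)) n (mkS (x, y)) := by
  rintro (q | q) m h
  · rw [mkS_inl] at h; exact hx q m h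
  · rw [mkS_inr] at h; exact hy q m h

theorem HomEl.shift {B : Type} {dB : B → ℕ} {n : ℕ} (e : ℕ)
    {y : B →₀ MvPolynomial V k}
    (hy : HomEl dB n y) : HomEl (fun p => dB p + e) (n + e) y := by
  intro q m h
  have := hy q m h
  simp only; omega

/-- the mapping cone resolution -/
theorem exists_cone {I J I' : Ideal (MvPolynomial V k)} (G : GR I) (K : GR J)
    {f : MvPolynomial V k} {e : ℕ} (hf : f.IsHomogeneous e) (hJ : ∀ y, y ∈ J ↔ y * f ∈ I)
    (hI' : ∀ x, x ∈ I' ↔ ∃ y, x - y * f ∈ I) :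
    ∃ C : GR I', ∀ i,
      (Finite (G.ι (i + 1)) → Finite (K.ι i) → Finite (C.ι (i + 1)) ∧
        Nat.card (C.ι (i + 1)) = Nat.card (G.ι (i + 1)) + Nat.card (K.ι i)) ∧
      ∀ P : ℕ → Prop, (∀ p, P (G.deg (i + 1) p)) → (∀ p, P (K.deg i p + e)) →
        ∀ p, P (C.deg (i + 1) p) := by
  obtain ⟨α, h0, hgr, hch⟩ := K.exists_chain G hf (fun y hy => (hJ y).1 hy)
  have hch' : ∀ i x, α i (K.d i x) = G.d i (α (i + 1) x) := fun i x => (hch i x).symm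
  have key : ∀ i (x : G.ι (i + 1) →₀ MvPolynomial V k) (u : K.ι (i + 1) →₀ MvPolynomial V k),
      G.d i x + α i (K.d i u) = 0 → ∃ v, G.d (i + 1) v + α (i + 1) (-u) = x := by
    intro i x u h
    rw [hch', ← map_add, G.ex] at h
    obtain ⟨v, hv⟩ := h
    exact ⟨v, by rw [hv, map_neg]; abel⟩
  have gr0 : IsGr (Sum.elim (G.deg 1) (fun p => K.deg 0 p + e)) (G.deg 0) 0
      (coneD0 (G.d 0) (α 0)) := by
    rintro (p | p)
    · rw [single_inl_eq, coneD0_mkS, map_zero, add_zero (G.d 0 _)]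
      exact G.gr 0 p
    · rw [single_inr_eq, coneD0_mkS, map_zero, zero_add]
      exact hgr 0 p
  have grS : ∀ i, IsGr (Sum.elim (G.deg (i + 2)) (fun p => K.deg (i + 1) p + e))
      (Sum.elim (G.deg (i + 1)) (fun p => K.deg i p + e)) 0
      (coneDS (G.d (i + 1)) (K.d i) (α (i + 1))) := by
    rintro i (p | p)
    · rw [single_inl_eq, coneDS_mkS, map_zero, map_zero, add_zero (G.d (i + 1) _), neg_zero]
      exact homEl_mkS (G.gr (i + 1) p) (HomEl.zero _ _)
    · rw [single_inr_eq, coneDS_mkS, map_zero, zero_add]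
      exact homEl_mkS (hgr (i + 1) p) ((K.gr i p).shift e).neg
  have ex0 : ∀ x : G.ι 0 →₀ MvPolynomial V k,
      x ∈ LinearMap.range (coneD0 (G.d 0) (α 0)) ↔ x G.z ∈ I' := by
    intro x
    rw [hI']
    constructor
    · rintro ⟨w, rfl⟩
      obtain ⟨x, y, rfl⟩ : ∃ x y, w = mkS (x, y) := ⟨_, _, (mkS_parts w).symm⟩
      refine ⟨y K.z, ?_⟩
      rw [coneD0_mkS, h0, GR.mul0_apply, Finsupp.add_apply, Finsupp.single_eq_same,
        add_sub_cancel_right]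
      exact (G.ex0 _).1 ⟨_, rfl⟩
    · rintro ⟨y, hy⟩
      have h1 : (x - Finsupp.single G.z (y * f)) G.z ∈ I := by simpa using hy
      obtain ⟨w, hw⟩ := (G.ex0 _).2 h1
      refine ⟨mkS (w, Finsupp.single K.z y), ?_⟩
      rw [coneD0_mkS, h0, GR.mul0_apply, hw, Finsupp.single_eq_same]
      exact sub_add_cancel _ _
  have ex1 : ∀ w, coneD0 (G.d 0) (α 0) w = 0 ↔
      w ∈ LinearMap.range (coneDS (G.d 1) (K.d 0) (α 1)) := by
    intro w
    constructor
    · intro h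
      obtain ⟨x, y, rfl⟩ : ∃ x y, w = mkS (x, y) := ⟨_, _, (mkS_parts w).symm⟩
      rw [coneD0_mkS] at h
      have hy : y ∈ LinearMap.range (K.d 0) := by
        rw [K.ex0, hJ]
        rw [h0, GR.mul0_apply] at h
        have h2 := (G.ex0 (-(G.d 0 x))).1 ⟨-x, map_neg _ _⟩
        rw [← eq_neg_iff_add_eq_zero.2 (by rw [add_comm]; exact h)] at h2
        simpa using h2
      obtain ⟨u, rfl⟩ := hy
      obtain ⟨v, hv⟩ := key 0 x u h
      refine ⟨mkS (v, -u), ?_⟩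
      rw [coneDS_mkS]
      rw [show G.d 1 v + α 1 (-u) = x from hv, map_neg, neg_neg]
    · rintro ⟨w', rfl⟩
      obtain ⟨x, y, rfl⟩ : ∃ x y, w' = mkS (x, y) := ⟨_, _, (mkS_parts w').symm⟩
      rw [coneDS_mkS, coneD0_mkS, map_add, map_neg, hch']
      rw [show G.d 0 (G.d 1 x) = 0 from G.dd 0 x]
      simp
  have exS : ∀ i w, coneDS (G.d (i + 1)) (K.d i) (α (i + 1)) w = 0 ↔
      w ∈ LinearMap.range (coneDS (G.d (i + 2)) (K.d (i + 1)) (α (i + 2))) := by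
    intro i w
    constructor
    · intro h
      obtain ⟨x, y, rfl⟩ : ∃ x y, w = mkS (x, y) := ⟨_, _, (mkS_parts w).symm⟩
      rw [coneDS_mkS] at h
      obtain ⟨h, hy⟩ := (mkS_zero_iff _ _).1 h
      rw [neg_eq_zero, K.ex] at hy
      obtain ⟨u, rfl⟩ := hy
      obtain ⟨v, hv⟩ := key (i + 1) x u h
      refine ⟨mkS (v, -u), ?_⟩
      rw [coneDS_mkS]
      rw [show G.d (i + 2) v + α (i + 2) (-u) = x from hv, map_neg, neg_neg]
    · rintro ⟨w', rfl⟩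
      obtain ⟨x, y, rfl⟩ : ∃ x y, w' = mkS (x, y) := ⟨_, _, (mkS_parts w').symm⟩
      rw [coneDS_mkS, coneDS_mkS, mkS_zero_iff, map_add, map_neg, hch', map_neg, K.dd]
      rw [show G.d (i + 1) (G.d (i + 2) x) = 0 from G.dd (i + 1) x]
      simp
  refine ⟨⟨coneι G.ι K.ι, coneDeg G.deg K.deg e, G.z, G.hz, G.deg_z, coneD G.d K.d α,
    ?_, ex0, ?_⟩, ?_⟩
  · rintro (_ | i)
    · exact gr0
    · exact grS i
  · rintro (_ | i)
    · exact ex1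
    · exact exS i
  · intro i
    constructor
    · intro _ _
      exact ⟨inferInstanceAs (Finite (G.ι (i + 1) ⊕ K.ι i)),
        Nat.card_sum (α := G.ι (i + 1)) (β := K.ι i)⟩
    · rintro P h1 h2 (p | p)
      · exact h1 p
      · exact h2 p

end Cone
section Compare

variable {k V : Type} [Field k]

theorem cc_map {A B : Type}
    (h : (A →₀ MvPolynomial V k) →ₗ[MvPolynomial V k] (B →₀ MvPolynomial V k))
    (x : A →₀ MvPolynomial V k) (p : B) :
    constantCoeff (h x p) = ∑ q ∈ x.support,
      constantCoeff (x q) * constantCoeff (h (Finsupp.single q 1) p) := by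
  classical
  have : h x = ∑ q ∈ x.support, x q • h (Finsupp.single q 1) := by
    conv_lhs => rw [← Finsupp.sum_single x, Finsupp.sum, map_sum]
    exact Finset.sum_congr rfl fun q _ => map_single_eq h q (x q)
  rw [this, Finsupp.finsetSum_apply, map_sum]
  simp

theorem GR.compare {I : Ideal (MvPolynomial V k)} (F G : GR I)
    (hmin : ∀ i x p, constantCoeff (F.d i x p) = 0) (i j : ℕ)
    [Finite {p : F.ι i // F.deg i p = j}] [Finite {p : G.ι i // G.deg i p = j}] :
    Nat.card {p : F.ι i // F.deg i p = j} ≤ Nat.card {p : G.ι i // G.deg i p = j} := by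
  classical
  have h1 : (1 : MvPolynomial V k).IsHomogeneous 0 := isHomogeneous_one _ _
  obtain ⟨φ, φ0, φg, φc⟩ := F.exists_chain G h1 (by simp)
  obtain ⟨ψ, ψ0, ψg, ψc⟩ := G.exists_chain F h1 (by simp)
  let θ : ∀ i, (F.ι i →₀ MvPolynomial V k) →ₗ[MvPolynomial V k] (F.ι i →₀ MvPolynomial V k) :=
    fun i => ψ i ∘ₗ φ i - LinearMap.id
  have θc : ∀ i x, F.d i (θ (i + 1) x) = θ i (F.d i x) := by
    intro i x
    simp only [θ, LinearMap.sub_apply, LinearMap.comp_apply, LinearMap.id_apply, map_sub, ψc, φc]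
  have θ0 : θ 0 = 0 := by
    ext1 p
    ext1
    simp only [θ, φ0, ψ0, LinearMap.comp_apply, LinearMap.sub_apply, GR.mul0_apply,
      Finsupp.lsingle_apply, LinearMap.id_apply]
    rw [F.hz p]
    simp
  have step : ∀ i (h : (F.ι i →₀ MvPolynomial V k) →ₗ[MvPolynomial V k]
      (F.ι (i + 1) →₀ MvPolynomial V k)), (∀ x, θ i (F.d i x) = F.d i (h (F.d i x))) →
      ∃ h' : (F.ι (i + 1) →₀ MvPolynomial V k) →ₗ[MvPolynomial V k]
        (F.ι (i + 2) →₀ MvPolynomial V k),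
        ∀ x, F.d (i + 1) (h' x) = (θ (i + 1) - h ∘ₗ F.d i) x := by
    intro i h hh
    apply exists_lift
    intro x
    rw [← F.ex]
    simp only [LinearMap.sub_apply, LinearMap.comp_apply, map_sub, θc, hh, sub_self]
  have ex : ∀ i, ∃ h : (F.ι i →₀ MvPolynomial V k) →ₗ[MvPolynomial V k]
      (F.ι (i + 1) →₀ MvPolynomial V k), ∀ x, θ i (F.d i x) = F.d i (h (F.d i x)) := by
    intro i
    induction i with
    | zero => exact ⟨0, by simp [θ0]⟩
    | succ i ih =>
      obtain ⟨h, hh⟩ := ih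
      obtain ⟨h', hh'⟩ := step i h hh
      refine ⟨h', fun x => ?_⟩
      rw [hh']
      simp [F.dd]
  have hθ : ∀ i x p, constantCoeff (θ i x p) = 0 := by
    rintro (_ | i) x p
    · simp [θ0]
    · obtain ⟨h, hh⟩ := ex i
      obtain ⟨h', hh'⟩ := step i h hh
      have : θ (i + 1) x = F.d (i + 1) (h' x) + h (F.d i x) := by
        rw [hh']; simp
      rw [this, Finsupp.add_apply, map_add, hmin, cc_map, zero_add]
      exact Finset.sum_eq_zero fun q _ => by rw [hmin, zero_mul]
  have := Fintype.ofFinite {p : F.ι i // F.deg i p = j}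
  have := Fintype.ofFinite {p : G.ι i // G.deg i p = j}
  let M : Matrix {p : F.ι i // F.deg i p = j} {p : G.ι i // G.deg i p = j} k :=
    fun p q => constantCoeff (φ i (Finsupp.single p.1 1) q.1)
  let N : Matrix {p : G.ι i // G.deg i p = j} {p : F.ι i // F.deg i p = j} k :=
    fun q p => constantCoeff (ψ i (Finsupp.single q.1 1) p.1)
  have hMN : M * N = 1 := by
    ext p p'
    rw [Matrix.mul_apply]
    have e1 := cc_map (ψ i) (φ i (Finsupp.single p.1 1)) p'.1
    have e2 := hθ i (Finsupp.single p.1 1) p'.1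
    simp only [θ, LinearMap.sub_apply, LinearMap.comp_apply, LinearMap.id_apply,
      Finsupp.sub_apply, map_sub, sub_eq_zero] at e2
    rw [e1] at e2
    have e3 : (1 : Matrix {p : F.ι i // F.deg i p = j} {p : F.ι i // F.deg i p = j} k) p p' =
        constantCoeff ((Finsupp.single p.1 (1 : MvPolynomial V k)) p'.1) := by
      rw [Matrix.one_apply, Finsupp.single_apply]
      by_cases hp : p = p'
      · simp [hp]
      · have : p.1 ≠ p'.1 := fun h => hp (Subtype.ext h)
        simp [hp, this]
    rw [e3, ← e2]
    have e4 : ∀ q, constantCoeff (φ i (Finsupp.single p.1 1) q) ≠ 0 → G.deg i q = j := by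
      intro q hq
      have := φg i p.1 q 0 hq
      rw [← p.2]
      simpa using this
    symm
    rw [← Finset.sum_filter_of_ne (p := fun q => G.deg i q = j)
      (fun q _ hq => e4 q (left_ne_zero_of_mul hq))]
    refine Finset.sum_bij_ne_zero
      (fun q hq _ => (⟨q, (Finset.mem_filter.1 hq).2⟩ : {p : G.ι i // G.deg i p = j}))
      (fun _ _ _ => Finset.mem_univ _) ?_ ?_ ?_
    · intro a _ _ b _ _ h
      exact congrArg Subtype.val h
    · intro b _ hb
      refine ⟨b.1, ?_, hb, rfl⟩
      rw [Finset.mem_filter, Finsupp.mem_support_iff]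
      refine ⟨fun h0 => ?_, b.2⟩
      apply hb
      simp only [M, h0, map_zero, zero_mul]
    · intro a _ _
      rfl
  rw [Nat.card_eq_fintype_card, Nat.card_eq_fintype_card]
  have r1 := Matrix.rank_mul_le_left M N
  rw [hMN, Matrix.rank_one] at r1
  exact r1.trans (Matrix.rank_le_card_width M)

end Compare
section Final

variable {k V : Type} [Field k]

theorem exists_GR_bot : ∃ G : GR (⊥ : Ideal (MvPolynomial V k)), ∀ i, IsEmpty (G.ι (i + 1)) := by
  let J : ℕ → Type := fun i => match i with
    | 0 => Unit
    | (_ + 1) => Empty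
  have hE : ∀ i, IsEmpty (J (i + 1)) := fun i => inferInstanceAs (IsEmpty Empty)
  have hS : ∀ i (x : J (i + 1) →₀ MvPolynomial V k), x = 0 := by
    intro i x
    ext p
    exact (hE i).elim p
  refine ⟨⟨J, fun _ _ => 0, (), fun p => rfl, rfl, fun _ => 0, ?_, ?_, ?_⟩, hE⟩
  · intro i p
    exact (hE i).elim p
  · intro x
    constructor
    · rintro ⟨y, rfl⟩
      simp
    · intro h
      refine ⟨0, ?_⟩
      refine Finsupp.ext fun p => ?_
      exact ((Ideal.mem_bot).1 h).symm
  · intro i x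
    rw [hS i x]
    simp

/-- numerical data of the Koszul resolution -/
def KData {I : Ideal (MvPolynomial V k)} (K : GR I) (r d : ℕ) : Prop :=
  ∀ i, Finite (K.ι i) ∧ Nat.card (K.ι i) = r.choose i ∧ ∀ p, K.deg i p = i * d

theorem GR.zeroData {I : Ideal (MvPolynomial V k)} (K : GR I) :
    Finite (K.ι 0) ∧ Nat.card (K.ι 0) = 1 ∧ ∀ p, K.deg 0 p = 0 := by
  have : Unique (K.ι 0) := ⟨⟨K.z⟩, K.hz⟩
  exact ⟨inferInstance, Nat.card_unique, fun p => by rw [K.hz p, K.deg_z]⟩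

theorem exists_koszul (L : List (MvPolynomial V k)) (d : ℕ) (hL : ∀ f ∈ L, f.IsHomogeneous d)
    (hreg : RingTheory.Sequence.IsWeaklyRegular (MvPolynomial V k) L) (n : ℕ)
    (hn : n ≤ L.length) :
    ∃ K : GR (Ideal.ofList (L.take n)), KData K n d := by
  induction n with
  | zero =>
    obtain ⟨G, hG⟩ := exists_GR_bot (k := k) (V := V)
    have : Ideal.ofList (L.take 0) = ⊥ := by simp
    rw [this]
    refine ⟨G, ?_⟩
    rintro (_ | i)
    · simpa using G.zeroData
    · have := hG i
      exact ⟨inferInstance, by simp, fun p => (hG i).elim p⟩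
  | succ n ih =>
    obtain ⟨K, hK⟩ := ih (by omega)
    have hn' : n < L.length := hn
    have hf := hL L[n] (List.getElem_mem hn')
    have hr := hreg.regular_mod_prev n hn'
    have hJ : ∀ y, y ∈ Ideal.ofList (L.take n) ↔ y * L[n] ∈ Ideal.ofList (L.take n) := by
      intro y
      refine ⟨fun h => Ideal.mul_mem_right _ _ h, fun h => ?_⟩
      have e : (Ideal.ofList (L.take n) • ⊤ : Submodule (MvPolynomial V k) (MvPolynomial V k)) =
        Ideal.ofList (L.take n) := by simp
      rw [e] at hr
      have h2 : L[n] • (Submodule.Quotient.mk y : MvPolynomial V k ⧸ Ideal.ofList (L.take n)) =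
          L[n] • 0 := by
        rw [smul_zero, ← Submodule.Quotient.mk_smul, Submodule.Quotient.mk_eq_zero, smul_eq_mul,
          mul_comm]
        exact h
      exact (Submodule.Quotient.mk_eq_zero _).1 (hr h2)
    have hI' : ∀ x, x ∈ Ideal.ofList (L.take (n + 1)) ↔
        ∃ y, x - y * L[n] ∈ Ideal.ofList (L.take n) := by
      intro x
      rw [← List.take_append_getElem hn', Ideal.ofList_append, Ideal.ofList_singleton,
        sup_comm, Ideal.mem_span_singleton_sup]
      constructor
      · rintro ⟨a, b, hb, rfl⟩
        exact ⟨a, by simpa using hb⟩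
      · rintro ⟨y, hy⟩
        exact ⟨y, _, hy, by ring⟩
    obtain ⟨C, hC⟩ := exists_cone K K hf hJ hI'
    refine ⟨C, ?_⟩
    rintro (_ | i)
    · simpa using C.zeroData
    · obtain ⟨h1, h2⟩ := hC i
      obtain ⟨h3, h4⟩ := h1 (hK _).1 (hK _).1
      refine ⟨h3, ?_, ?_⟩
      · rw [h4, (hK _).2.1, (hK _).2.1, Nat.choose_succ_succ, add_comm]
      · apply h2 (fun t => t = (i + 1) * d)
        · exact (hK (i + 1)).2.2
        · intro p
          rw [(hK i).2.2 p]; ring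

theorem isHomogeneous_sqMonomial [DecidableEq V] (F : Finset V) :
    (sqMonomial k F).IsHomogeneous F.card := by
  unfold sqMonomial
  have := IsHomogeneous.prod F (fun v => (X v : MvPolynomial V k)) (fun _ => 1)
    (fun v _ => isHomogeneous_X k v)
  simpa using this

theorem exists_main [DecidableEq V]
    (d d' t : ℕ) (m : Fin t → Finset V)
    (hcard : ∀ s, (m s).card = d')
    (B : Fin t → Finset (Finset V))
    (hBdeg : ∀ s, ∀ b ∈ B s, b.card = d)
    (hcolon : ∀ s : Fin t,
      Submodule.colon
          (Ideal.span {p | ∃ s' : Fin t, s' < s ∧ p = sqMonomial k (m s')})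
          (Ideal.span {sqMonomial k (m s)}) =
        Ideal.span ((fun b : Finset V => sqMonomial k b) '' ↑(B s)))
    (hreg : ∀ s : Fin t, ∃ L : List (Finset V), L.Nodup ∧ L.toFinset = B s ∧
      RingTheory.Sequence.IsRegular (MvPolynomial V k)
        (L.map fun b => sqMonomial k b)) (n : ℕ) (hn : n ≤ t) :
    ∃ G : GR (Ideal.span {p | ∃ s' : Fin t, s'.1 < n ∧ p = sqMonomial k (m s')}),
      ∀ i, Finite (G.ι (i + 1)) ∧
        Nat.card (G.ι (i + 1)) = ∑ s : Fin t, (if s.1 < n then (B s).card.choose i else 0) ∧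
        ∀ p, G.deg (i + 1) p = d' + i * d := by
  induction n with
  | zero =>
    obtain ⟨G, hG⟩ := exists_GR_bot (k := k) (V := V)
    have : Ideal.span {p | ∃ s' : Fin t, s'.1 < 0 ∧ p = sqMonomial k (m s')} = ⊥ := by
      simp
    rw [this]
    refine ⟨G, fun i => ?_⟩
    have := hG i
    exact ⟨inferInstance, by simp, fun p => (hG i).elim p⟩
  | succ n ih =>
    obtain ⟨G, hG⟩ := ih (by omega)
    let s : Fin t := ⟨n, hn⟩
    obtain ⟨L, hnd, hLB, hL⟩ := hreg s
    obtain ⟨K, hK⟩ := exists_koszul (L.map fun b => sqMonomial k b) d (by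
      intro f hf
      obtain ⟨b, hb, rfl⟩ := List.mem_map.1 hf
      have hb' : b ∈ B s := by rw [← hLB]; simpa using hb
      rw [← hBdeg s b hb']
      exact isHomogeneous_sqMonomial b) hL.toIsWeaklyRegular _ le_rfl
    have hlen : (L.map fun b => sqMonomial k b).length = (B s).card := by
      rw [List.length_map, ← hLB, List.toFinset_card_of_nodup hnd]
    have hK : KData K (B s).card d := by
      intro i
      rw [← hlen]
      exact hK i
    have hJ : ∀ y, y ∈ Ideal.ofList ((L.map fun b => sqMonomial k b).take
        (L.map fun b => sqMonomial k b).length) ↔ y * sqMonomial k (m s) ∈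
        Ideal.span {p | ∃ s' : Fin t, s'.1 < n ∧ p = sqMonomial k (m s')} := by
      intro y
      have e : Ideal.ofList ((L.map fun b => sqMonomial k b).take
        (L.map fun b => sqMonomial k b).length) =
          Ideal.span ((fun b : Finset V => sqMonomial k b) '' ↑(B s)) := by
        rw [List.take_length, ← hLB]
        unfold Ideal.ofList
        congr 1
        ext p
        simp
      rw [e, ← hcolon s, Submodule.mem_colon]
      constructor
      · intro h
        exact h _ (Ideal.mem_span_singleton_self _)
      · intro h p hp
        obtain ⟨a, rfl⟩ := Ideal.mem_span_singleton'.1 hp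
        have := Ideal.mul_mem_left _ a h
        rw [smul_eq_mul, mul_left_comm]
        exact this
    have hI' : ∀ x, x ∈ Ideal.span {p | ∃ s' : Fin t, s'.1 < n + 1 ∧ p = sqMonomial k (m s')} ↔
        ∃ y, x - y * sqMonomial k (m s) ∈
          Ideal.span {p | ∃ s' : Fin t, s'.1 < n ∧ p = sqMonomial k (m s')} := by
      intro x
      have e : {p | ∃ s' : Fin t, s'.1 < n + 1 ∧ p = sqMonomial k (m s')} =
          {sqMonomial k (m s)} ∪ {p | ∃ s' : Fin t, s'.1 < n ∧ p = sqMonomial k (m s')} := by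
        ext p
        constructor
        · rintro ⟨s', h, rfl⟩
          by_cases h' : s'.1 < n
          · exact Or.inr ⟨s', h', rfl⟩
          · have : s' = s := Fin.ext (by simp only [s]; omega)
            exact Or.inl (by rw [this]; rfl)
        · rintro (h | ⟨s', h, rfl⟩)
          · exact ⟨s, Nat.lt_succ_self n, h⟩
          · exact ⟨s', by omega, rfl⟩
      rw [e, Ideal.span_union, Ideal.mem_span_singleton_sup]
      constructor
      · rintro ⟨a, b, hb, rfl⟩
        exact ⟨a, by simpa using hb⟩
      · rintro ⟨y, hy⟩
        exact ⟨y, _, hy, by ring⟩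
    have hf : (sqMonomial k (m s)).IsHomogeneous d' := by
      rw [← hcard s]; exact isHomogeneous_sqMonomial _
    obtain ⟨C, hC⟩ := exists_cone G K hf hJ hI'
    refine ⟨C, fun i => ?_⟩
    obtain ⟨h1, h2⟩ := hC i
    obtain ⟨h3, h4⟩ := h1 (hG _).1 (hK _).1
    refine ⟨h3, ?_, ?_⟩
    · rw [h4, (hG i).2.1, (hK i).2.1]
      have : (B s).card.choose i = ∑ s' : Fin t, if s' = s then (B s').card.choose i else 0 := by
        simp
      rw [this, ← Finset.sum_add_distrib]
      apply Finset.sum_congr rfl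
      intro s' _
      by_cases h : s' = s
      · subst h
        simp [s]
      · have h' : s'.1 ≠ n := fun h' => h (Fin.ext h')
        by_cases h'' : s'.1 < n
        · simp [h, h'', show s'.1 < n + 1 by omega]
        · simp [h, h'', show ¬ s'.1 < n + 1 by omega]
    · apply h2 (fun x => x = d' + i * d)
      · exact (hG i).2.2
      · intro p
        rw [(hK i).2.2 p]; ring

theorem exists_ofMin [Fintype V] [DecidableEq V] {I : Ideal (MvPolynomial V k)}
    (F : MinimalGradedFreeResolution k V I) :
    ∃ G : GR I, (∀ i x p, constantCoeff (G.d i x p) = 0) ∧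
      ∀ i j, Finite {p : G.ι i // G.deg i p = j} ∧
        Nat.card {p : G.ι i // G.deg i p = j} = F.β i j := by
  have h00 : F.β 0 0 = 1 := by simp [F.β_zero]
  let z : Σ j : ℕ, Fin (F.β 0 j) := ⟨0, ⟨0, by omega⟩⟩
  have hz : ∀ p, p = z := by
    rintro ⟨j, q⟩
    by_cases hj : j = 0
    · subst hj
      have : q = ⟨0, by omega⟩ := Fin.ext (by have := q.2; simp only; omega)
      rw [this]
    · have h1 : F.β 0 j = 0 := by rw [F.β_zero, if_neg hj]
      have h := q.2
      omega
  have hx : ∀ x : (Σ j : ℕ, Fin (F.β 0 j)) →₀ MvPolynomial V k,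
      F.aug x = x z • F.aug (Finsupp.single z 1) := by
    intro x
    have : x = Finsupp.single z (x z) := by
      ext p : 1
      rw [hz p]; simp
    conv_lhs => rw [this]
    exact map_single_eq _ _ _
  refine ⟨⟨fun i => Σ j : ℕ, Fin (F.β i j), fun i p => p.1, z, hz, rfl, F.d, ?_, ?_, ?_⟩,
    F.minimal, ?_⟩
  · rintro i ⟨j, t⟩ q mm hm
    obtain ⟨h1, h2⟩ := F.graded i j t q
    rcases h2 with h2 | h2
    · by_contra hc
      apply hm
      apply h1.coeff_eq_zero
      simp only at hc
      omega
    · rw [h2] at hm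
      simp at hm
  · intro x
    rw [← F.exact_zero, LinearMap.mem_ker, hx]
    constructor
    · intro h
      obtain ⟨y, hy⟩ := F.aug_surjective (Submodule.Quotient.mk 1)
      rw [hx] at hy
      have h3 : x z • (Submodule.Quotient.mk 1 : MvPolynomial V k ⧸ I) = 0 := by
        rw [← hy, smul_comm, h, smul_zero]
      rw [← Submodule.Quotient.mk_smul, Submodule.Quotient.mk_eq_zero, smul_eq_mul, mul_one] at h3
      exact h3
    · intro h
      obtain ⟨u, hu⟩ := Submodule.Quotient.mk_surjective _ (F.aug (Finsupp.single z 1))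
      rw [← hu, ← Submodule.Quotient.mk_smul, Submodule.Quotient.mk_eq_zero, smul_eq_mul]
      exact Ideal.mul_mem_right _ _ h
  · intro i x
    rw [← F.exact_succ, LinearMap.mem_ker]
  · intro i j
    let e : {p : (Σ j : ℕ, Fin (F.β i j)) // p.1 = j} ≃ Fin (F.β i j) :=
      Equiv.sigmaSubtype j
    exact ⟨Finite.of_equiv _ e.symm, by rw [Nat.card_congr e, Nat.card_fin]⟩

end Final
/-- Let `I = (x^{m 0}, …, x^{m (t-1)})` be a squarefree monomial ideal
of `R = k[x_v : v ∈ V]` with all minimal generators of degree `d'`, having `d`-quotients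
(`d ≤ d'`) with respect to this ordering, say
`(x^{m 0}, …, x^{m (s-1)}) : x^{m s} = (x^b : b ∈ B s)` with all `|b| = d`, and assume
that for every `s` the minimal monomial generators `{x^b : b ∈ B s}` of this colon ideal
form a regular sequence (of length `r_s = |B s|`).  Then `β_{i,j}(R ⧸ I)` is nonzero
only for `j = i + d' - 1 + (i-1)(d-1)`, and for all `2 ≤ i ≤ pd_R(R ⧸ I)`,
`β_i(R ⧸ I) = ∑_s C(r_s, i - 1)`. -/
theorem betti_of_dQuotients_regular (k V : Type) [Field k] [Fintype V] [DecidableEq V]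
    (d d' t : ℕ) (hdd : d ≤ d') (m : Fin t → Finset V)
    (hinj : Function.Injective m)
    (hcard : ∀ s, (m s).card = d')
    (B : Fin t → Finset (Finset V))
    (hBdeg : ∀ s, ∀ b ∈ B s, b.card = d)
    (hcolon : ∀ s : Fin t,
      Submodule.colon
          (Ideal.span {p | ∃ s' : Fin t, s' < s ∧ p = sqMonomial k (m s')})
          (Ideal.span {sqMonomial k (m s)}) =
        Ideal.span ((fun b : Finset V => sqMonomial k b) '' ↑(B s)))
    (hreg : ∀ s : Fin t, ∃ L : List (Finset V), L.Nodup ∧ L.toFinset = B s ∧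
      RingTheory.Sequence.IsRegular (MvPolynomial V k)
        (L.map fun b => sqMonomial k b))
    (F : MinimalGradedFreeResolution k V
      (Ideal.span (Set.range fun s => sqMonomial k (m s)))) :
    (∀ i j, 1 ≤ i → F.β i j ≠ 0 → j = i + d' - 1 + (i - 1) * (d - 1)) ∧
      (∀ i, 2 ≤ i → (∃ i', i ≤ i' ∧ ∃ j, F.β i' j ≠ 0) →
        (∑' j : ℕ, (F.β i j : ℕ∞)) = ∑ s : Fin t, (((B s).card.choose (i - 1) : ℕ)) ) := by
  obtain ⟨F', hmin, hF⟩ := exists_ofMin F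
  have hex := exists_main d d' t m hcard B hBdeg hcolon hreg t le_rfl
  have hI : Ideal.span {p | ∃ s' : Fin t, s'.1 < t ∧ p = sqMonomial k (m s')} =
      Ideal.span (Set.range fun s => sqMonomial k (m s)) := by
    congr 1
    ext p
    constructor
    · rintro ⟨s, _, rfl⟩
      exact ⟨s, rfl⟩
    · rintro ⟨s, rfl⟩
      exact ⟨s, s.2, rfl⟩
  rw [hI] at hex
  obtain ⟨G, hG⟩ := hex
  have hN : ∀ i, Nat.card (G.ι (i + 1)) = ∑ s : Fin t, (B s).card.choose i := by
    intro i
    rw [(hG i).2.1]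
    exact Finset.sum_congr rfl fun s _ => if_pos s.2
  have hd0 : d = 0 → ∀ s, B s = ∅ := by
    intro hd s
    rw [Finset.eq_empty_iff_forall_notMem]
    intro b hb
    obtain ⟨L, _, hLB, hL⟩ := hreg s
    have hb0 : b = ∅ := Finset.card_eq_zero.1 ((hBdeg s b hb).trans hd)
    apply hL.top_ne_smul
    have h1 : (1 : MvPolynomial V k) ∈ L.map fun b => sqMonomial k b := by
      rw [List.mem_map]
      refine ⟨b, ?_, by simp [hb0, sqMonomial]⟩
      rw [← hLB] at hb
      simpa using hb
    have h2 : Ideal.ofList (L.map fun b => sqMonomial k b) = ⊤ := by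
      rw [Ideal.eq_top_iff_one]
      exact Ideal.subset_span h1
    rw [h2]
    simp
  have hd0' : d = 0 → ∀ i, 1 ≤ i → Nat.card (G.ι (i + 1)) = 0 := by
    intro hd i hi
    rw [hN]
    refine Finset.sum_eq_zero fun s _ => ?_
    rw [hd0 hd s, Finset.card_empty]
    exact Nat.choose_eq_zero_of_lt hi
  have hle : ∀ i j, F.β (i + 1) j ≤ Nat.card {p : G.ι (i + 1) // G.deg (i + 1) p = j} := by
    intro i j
    have := (hF (i + 1) j).1
    have := (hG i).1
    rw [← (hF (i + 1) j).2]
    exact GR.compare F' G hmin (i + 1) j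
  have hdeg : ∀ i j, F.β (i + 1) j ≠ 0 → j = d' + i * d ∧ Nat.card (G.ι (i + 1)) ≠ 0 := by
    intro i j h
    have h1 := hle i j
    have h2 : Nat.card {p : G.ι (i + 1) // G.deg (i + 1) p = j} ≠ 0 := by omega
    have := (hG i).1
    obtain ⟨⟨p, hp⟩⟩ : Nonempty {p : G.ι (i + 1) // G.deg (i + 1) p = j} :=
      (Nat.card_ne_zero.1 h2).1
    exact ⟨by rw [← hp, (hG i).2.2], Nat.card_ne_zero.2 ⟨⟨p⟩, this⟩⟩
  have hcG : ∀ i, Nat.card {p : G.ι (i + 1) // G.deg (i + 1) p = d' + i * d} =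
      Nat.card (G.ι (i + 1)) := by
    intro i
    exact Nat.card_congr (Equiv.subtypeUnivEquiv (hG i).2.2)
  have heq : ∀ i, 1 ≤ i → F.β (i + 1) (d' + i * d) = Nat.card (G.ι (i + 1)) := by
    intro i hi
    apply le_antisymm
    · rw [← hcG]; exact hle _ _
    · by_cases hd : d = 0
      · rw [hd0' hd i hi]; exact Nat.zero_le _
      · have hGmin : ∀ i x p, constantCoeff (G.d i x p) = 0 := by
          intro i x p
          rw [cc_map]
          refine Finset.sum_eq_zero fun q _ => ?_
          by_contra hc
          have h1 := G.gr i q p 0 (right_ne_zero_of_mul hc)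
          rw [(hG i).2.2 q] at h1
          rcases i with _ | i
          · rw [G.zeroData.2.2 p] at h1
            simp at h1
            omega
          · rw [(hG i).2.2 p, add_mul] at h1
            simp at h1
            omega
        have := (hF (i + 1) (d' + i * d)).1
        have := (hG i).1
        rw [← hcG, ← (hF (i + 1) (d' + i * d)).2]
        exact GR.compare G F' hGmin _ _
  constructor
  · intro i j hi hij
    obtain ⟨i, rfl⟩ := Nat.exists_eq_add_of_le' hi
    obtain ⟨h1, h2⟩ := hdeg i j hij
    rcases Nat.eq_zero_or_pos d with hd | hd
    · rcases Nat.eq_zero_or_pos i with h0 | h0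
      · subst h0; simp [h1]
      · exact absurd (hd0' hd i h0) h2
    · obtain ⟨e, rfl⟩ := Nat.exists_eq_add_of_le' hd
      rw [h1, Nat.add_sub_cancel, Nat.add_sub_cancel, show i + 1 + d' - 1 = i + d' by omega]
      ring
  · intro i hi _
    obtain ⟨i, rfl⟩ := Nat.exists_eq_add_of_le' (show 1 ≤ i by omega)
    rw [tsum_eq_single (d' + i * d), heq i (by omega), hN, Nat.add_sub_cancel]
    intro j hj
    by_contra hc
    apply hj
    exact (hdeg i j (fun h => hc (by rw [h]; rfl))).1
end
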